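/- Let n = 2m ≥ 4 be an even integer and c_n = 2^{n-2}((n-2)/2)! π^{n/2}. Let u : ℝⁿ → ℝ be smooth with (-Δ)^m u = 2 Q e^{nu}, f := Q e^{nu} ∈ L¹(ℝⁿ), and suppose that for every δ > 0 there is R_δ such that Q(x) ≥ e^{-δ|x|²} for |x| ≥ R_δ, and that ∫₀^∞ e^{u(rθ)} dr = +∞ for every unit vector θ. Then the metric is normal: there exists a constant C such that u(x) = (1/c_n)∫_{ℝⁿ} log(|y|/|x-y|) Q(y) e^{nu(y)} dy + C for every x ∈ ℝⁿ. -/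

import Mathlib

open MeasureTheory Real Filter Metric
open scoped ENNReal Topology

/-- The constant `c_n = 2^(n-2) * ((n-2)/2)! * pi^(n/2)`. -/
noncomputable def cconst (n : ℕ) : ℝ :=
  2 ^ (n - 2) * (Nat.factorial ((n - 2) / 2)) * Real.pi ^ (n / 2)

/-- The logarithmic potential `v x = (1/c_n) * ∫ log (|x-y|/|y|) f y dy`. -/
noncomputable def logPot (n : ℕ) (f : EuclideanSpace ℝ (Fin n) → ℝ)
    (x : EuclideanSpace ℝ (Fin n)) : ℝ :=
  (1 / cconst n) * ∫ y, Real.log (‖x - y‖ / ‖y‖) * f y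

/-- The Laplacian of `f : ℝ^n → ℝ`, as the trace of the second derivative. -/
noncomputable def laplacian {n : ℕ} (f : EuclideanSpace ℝ (Fin n) → ℝ)
    (x : EuclideanSpace ℝ (Fin n)) : ℝ :=
  ∑ i, iteratedFDeriv ℝ 2 f x ![EuclideanSpace.single i 1, EuclideanSpace.single i 1]

/-- The m-th iterate `(-Δ)^m` of the negative Laplacian. -/
noncomputable def negLapIter {n : ℕ} (m : ℕ) (f : EuclideanSpace ℝ (Fin n) → ℝ) :
    EuclideanSpace ℝ (Fin n) → ℝ :=
  (fun (g : EuclideanSpace ℝ (Fin n) → ℝ) x => -laplacian g x)^[m] f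


/-- A chain of smooth radial profiles, each the (scaled) primitive of the previous one. -/
structure Chain (w : ℕ → ℝ → ℝ) : Prop where
  smooth : ∀ i, ContDiff ℝ (⊤ : ℕ∞) (w i)
  nonneg : ∀ i ξ, 0 ≤ w i ξ
  zero : ∀ i ξ, 1 ≤ ξ → w i ξ = 0
  deriv : ∀ i ξ, HasDerivAt (w (i+1)) (-(1/2) * w i ξ) ξ
  one : ∀ ξ, ξ ≤ 1/2 → w 0 ξ = 1

/-- Successive primitives of a profile. -/
noncomputable def chainFn : ℕ → ℝ → ℝ
  | 0 => fun ξ => Real.smoothTransition (2 - 2 * ξ)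
  | (i+1) => fun ξ => - (1/2) * ∫ t in (1:ℝ)..ξ, chainFn i t

lemma chainFn_prop (i : ℕ) : ContDiff ℝ (⊤ : ℕ∞) (chainFn i) ∧ (∀ ξ, 0 ≤ chainFn i ξ) ∧
    (∀ ξ, 1 ≤ ξ → chainFn i ξ = 0) ∧
    (∀ ξ, HasDerivAt (chainFn (i+1)) (-(1/2) * chainFn i ξ) ξ) := by
  induction i with
  | zero =>
    have hs : ContDiff ℝ (⊤ : ℕ∞) (chainFn 0) := by
      unfold chainFn
      exact Real.smoothTransition.contDiff.comp (by fun_prop)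
    refine ⟨hs, fun ξ => Real.smoothTransition.nonneg _, fun ξ h => ?_, fun ξ => ?_⟩
    · exact Real.smoothTransition.zero_of_nonpos (by linarith)
    · have := (intervalIntegral.integral_hasDerivAt_right (hs.continuous.intervalIntegrable 1 ξ)
        (hs.continuous.stronglyMeasurableAtFilter _ _) hs.continuous.continuousAt)
      exact this.const_mul (-(1/2) : ℝ)
  | succ i ih =>
    obtain ⟨h1, h2, h3, h4⟩ := ih
    have hd : deriv (chainFn (i+1)) = fun ξ => -(1/2) * chainFn i ξ := funext fun ξ => (h4 ξ).deriv
    have hs : ContDiff ℝ (⊤ : ℕ∞) (chainFn (i+1)) := by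
      rw [contDiff_infty_iff_deriv]
      refine ⟨fun ξ => (h4 ξ).differentiableAt, ?_⟩
      rw [hd]; exact contDiff_const.mul h1
    have hz : ∀ ξ, 1 ≤ ξ → chainFn (i+1) ξ = 0 := by
      intro ξ hξ
      show - (1/2) * ∫ t in (1:ℝ)..ξ, chainFn i t = 0
      rw [intervalIntegral.integral_congr (g := fun _ => (0:ℝ))]
      · simp
      · intro t ht
        rw [Set.uIcc_of_le hξ] at ht
        exact h3 t ht.1
    refine ⟨hs, fun ξ => ?_, hz, fun ξ => ?_⟩
    · rcases le_total 1 ξ with h | h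
      · rw [hz ξ h]
      · show 0 ≤ - (1/2) * ∫ t in (1:ℝ)..ξ, chainFn i t
        rw [intervalIntegral.integral_symm]
        have : 0 ≤ ∫ t in ξ..1, chainFn i t :=
          intervalIntegral.integral_nonneg h (fun t _ => h2 t)
        linarith
    · have := (intervalIntegral.integral_hasDerivAt_right (hs.continuous.intervalIntegrable 1 ξ)
        (hs.continuous.stronglyMeasurableAtFilter _ _) hs.continuous.continuousAt)
      exact this.const_mul (-(1/2) : ℝ)

lemma chain_chainFn : Chain chainFn where
  smooth i := (chainFn_prop i).1
  nonneg i := (chainFn_prop i).2.1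
  zero i := (chainFn_prop i).2.2.1
  deriv i := (chainFn_prop i).2.2.2
  one ξ h := Real.smoothTransition.one_of_one_le (by linarith)

lemma Chain.antitone {w : ℕ → ℝ → ℝ} (hw : Chain w) (i : ℕ) : Antitone (w (i+1)) := by
  apply antitone_of_deriv_nonpos
  · exact fun ξ => (hw.deriv i ξ).differentiableAt
  · intro ξ
    rw [(hw.deriv i ξ).deriv]
    have := hw.nonneg i ξ
    linarith

/-- `d/dr w_{i+1}(r²) = - r w_i(r²)` -/
lemma Chain.deriv_sq {w : ℕ → ℝ → ℝ} (hw : Chain w) (i : ℕ) (r : ℝ) :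
    HasDerivAt (fun r => w (i+1) (r^2)) (-(r * w i (r^2))) r := by
  have h := (hw.deriv i (r^2)).comp r (hasDerivAt_pow 2 r)
  refine h.congr_deriv ?_
  push_cast; ring

lemma Chain.radial {w : ℕ → ℝ → ℝ} (hw : Chain w) (j : ℕ) : ∀ i,
    ∫ r in (0:ℝ)..1, r^(2*j+1) * w i (r^2) = 2^j * (Nat.factorial j) * w (i+j+1) 0 := by
  induction j with
  | zero =>
    intro i
    have : ∫ r in (0:ℝ)..1, (r * w i (r^2)) = -(w (i+1) (1^2)) - -(w (i+1) (0^2)) := by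
      apply intervalIntegral.integral_eq_sub_of_hasDerivAt (f := fun r => -(w (i+1) (r^2)))
      · intro r _
        have h := (hw.deriv_sq i r).fun_neg
        rwa [neg_neg] at h
      · exact (continuous_id.mul ((hw.smooth i).continuous.comp (continuous_pow 2))).intervalIntegrable _ _
    simp only [mul_zero, zero_add, pow_one, pow_zero, Nat.factorial_zero, Nat.cast_one, add_zero]
    rw [this, hw.zero (i+1) (1^2) (by norm_num)]
    simp
  | succ j ih =>
    intro i
    have h := intervalIntegral.integral_mul_deriv_eq_deriv_mul (a := 0) (b := 1)
      (u := fun r : ℝ => r^(2*j+2)) (v := fun r => w (i+1) (r^2))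
      (u' := fun r => (2*j+2:ℕ) * r^(2*j+1)) (v' := fun r => -(r * w i (r^2)))
      (fun r _ => by simpa using hasDerivAt_pow (2*j+2) r) (fun r _ => hw.deriv_sq i r)
      (Continuous.intervalIntegrable (by fun_prop) _ _)
      (Continuous.intervalIntegrable (by have := (hw.smooth i).continuous; fun_prop) _ _)
    have h2 := ih (i+1)
    have e1 : ∀ r : ℝ, r^(2*(j+1)+1) * w i (r^2) = -(r^(2*j+2) * -(r * w i (r^2))) := by
      intro r; ring
    simp_rw [e1]
    rw [intervalIntegral.integral_neg, h, hw.zero (i+1) (1^2) (by norm_num)]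
    simp_rw [mul_assoc, intervalIntegral.integral_const_mul, h2]
    rw [show i + 1 + j + 1 = i + (j+1) + 1 by ring, Nat.factorial_succ]
    push_cast
    simp
    ring

lemma Chain.total {w : ℕ → ℝ → ℝ} (hw : Chain w) {m n : ℕ} (hm : 1 ≤ m) (hn : n = 2 * m) :
    ∫ y : EuclideanSpace ℝ (Fin n), w 0 (‖y‖^2) = (2 * π)^m * w m 0 := by
  have : Nonempty (Fin n) := ⟨⟨0, by omega⟩⟩
  have : Nontrivial (EuclideanSpace ℝ (Fin n)) :=
    Module.nontrivial_of_finrank_pos (R := ℝ) (by rw [finrank_euclideanSpace_fin]; omega)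
  rw [integral_fun_norm_addHaar volume (fun r => w 0 (r^2))]
  rw [finrank_euclideanSpace_fin]
  have hv : (volume : Measure (EuclideanSpace ℝ (Fin n))).real (ball 0 1) = π^m / m.factorial := by
    rw [measureReal_def, EuclideanSpace.volume_ball]
    simp only [ENNReal.ofReal_one, one_pow, one_mul, Fintype.card_fin]
    rw [ENNReal.toReal_ofReal (by positivity)]
    rw [hn, pow_mul, Real.sq_sqrt Real.pi_pos.le]
    push_cast
    rw [mul_div_cancel_left₀ _ (two_ne_zero), Real.Gamma_nat_eq_factorial]
  have hI : ∫ r in Set.Ioi (0:ℝ), r^(n-1) • w 0 (r^2) = ∫ r in (0:ℝ)..1, r^(2*(m-1)+1) * w 0 (r^2) := by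
    rw [intervalIntegral.integral_of_le zero_le_one, show n - 1 = 2*(m-1)+1 by omega]
    simp only [smul_eq_mul]
    apply setIntegral_eq_of_subset_of_forall_sdiff_eq_zero measurableSet_Ioi Set.Ioc_subset_Ioi_self
    intro r hr
    rw [hw.zero 0, mul_zero]
    have h1 : (0:ℝ) < r := hr.1
    have h2 : ¬ (0 < r ∧ r ≤ 1) := hr.2
    have : 1 < r := by by_contra hh; exact h2 ⟨h1, not_lt.1 hh⟩
    nlinarith
  rw [hI, hw.radial, hv]
  obtain ⟨k, rfl⟩ : ∃ k, m = k + 1 := ⟨m - 1, by omega⟩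
  simp only [nsmul_eq_mul, smul_eq_mul, Nat.add_sub_cancel, Nat.factorial_succ, zero_add, hn]
  push_cast
  have : (k.factorial : ℝ) ≠ 0 := by positivity
  field_simp
  ring


section
variable {n : ℕ}

lemma laplacian_eq (g : EuclideanSpace ℝ (Fin n) → ℝ) (hg : ContDiff ℝ (⊤ : ℕ∞) g)
    (x : EuclideanSpace ℝ (Fin n)) :
    laplacian g x = ∑ k, fderiv ℝ (fun z => fderiv ℝ g z (EuclideanSpace.single k 1)) x
      (EuclideanSpace.single k 1) := by
  unfold laplacian
  refine Finset.sum_congr rfl fun k _ => ?_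
  rw [iteratedFDeriv_two_apply]
  have hd : DifferentiableAt ℝ (fderiv ℝ g) x :=
    ((hg.fderiv_right (m := (⊤ : ℕ∞)) (by norm_num)).differentiable (by simp)) x
  rw [fderiv_clm_apply hd (by fun_prop)]
  simp

lemma contDiff_laplacian (g : EuclideanSpace ℝ (Fin n) → ℝ) (hg : ContDiff ℝ (⊤ : ℕ∞) g) :
    ContDiff ℝ (⊤ : ℕ∞) (laplacian g) := by
  have : laplacian g = fun x => ∑ k, fderiv ℝ (fun z => fderiv ℝ g z (EuclideanSpace.single k 1)) x
      (EuclideanSpace.single k 1) := funext fun x => laplacian_eq g hg x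
  rw [this]
  refine ContDiff.sum fun k _ => ?_
  have h1 : ContDiff ℝ (⊤ : ℕ∞) (fun z => fderiv ℝ g z (EuclideanSpace.single k (1:ℝ))) :=
    (hg.fderiv_right (m := (⊤ : ℕ∞)) (by norm_num)).clm_apply contDiff_const
  exact (h1.fderiv_right (m := (⊤ : ℕ∞)) (by norm_num)).clm_apply contDiff_const

lemma contDiff_negLapIter (u : EuclideanSpace ℝ (Fin n) → ℝ) (hu : ContDiff ℝ (⊤ : ℕ∞) u) (i : ℕ) :
    ContDiff ℝ (⊤ : ℕ∞) (negLapIter i u) := by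
  induction i with
  | zero => exact hu
  | succ i ih =>
    unfold negLapIter at ih ⊢
    rw [Function.iterate_succ_apply']
    exact (contDiff_laplacian _ ih).neg

lemma negLapIter_succ (u : EuclideanSpace ℝ (Fin n) → ℝ) (i : ℕ) (x : EuclideanSpace ℝ (Fin n)) :
    negLapIter (i+1) u x = - laplacian (negLapIter i u) x := by
  unfold negLapIter
  rw [Function.iterate_succ_apply']

lemma Chain.cont_norm {w : ℕ → ℝ → ℝ} (hw : Chain w) (i : ℕ) : Continuous (fun y : EuclideanSpace ℝ (Fin n) => w i (‖y‖^2)) :=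
  (hw.smooth i).continuous.comp (by fun_prop)

lemma Chain.contDiff_norm {w : ℕ → ℝ → ℝ} (hw : Chain w) (i : ℕ) :
    ContDiff ℝ (⊤ : ℕ∞) (fun y : EuclideanSpace ℝ (Fin n) => w i (‖y‖^2)) :=
  (hw.smooth i).comp (contDiff_norm_sq ℝ)

lemma Chain.norm_zero {w : ℕ → ℝ → ℝ} (hw : Chain w) (i : ℕ) {y : EuclideanSpace ℝ (Fin n)} (hy : 1 ≤ ‖y‖) : w i (‖y‖^2) = 0 :=
  hw.zero i _ (by nlinarith)

lemma Chain.compactSupport {w : ℕ → ℝ → ℝ} (hw : Chain w) (i : ℕ) :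
    HasCompactSupport (fun y : EuclideanSpace ℝ (Fin n) => w i (‖y‖^2)) := by
  refine HasCompactSupport.intro (isCompact_closedBall 0 1) fun y hy => ?_
  refine hw.norm_zero i ?_
  simp at hy
  exact hy.le

lemma Chain.integrable_mul {w : ℕ → ℝ → ℝ} (hw : Chain w) (i : ℕ) {g : EuclideanSpace ℝ (Fin n) → ℝ} (hg : Continuous g) :
    Integrable (fun y : EuclideanSpace ℝ (Fin n) => w i (‖y‖^2) * g y) :=
  ((hw.cont_norm i).mul hg).integrable_of_hasCompactSupport (hw.compactSupport i).mul_right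

lemma Chain.fderiv_norm {w : ℕ → ℝ → ℝ} (hw : Chain w) (i : ℕ) (y v : EuclideanSpace ℝ (Fin n)) :
    fderiv ℝ (fun y : EuclideanSpace ℝ (Fin n) => w (i+1) (‖y‖^2)) y v
      = - (inner ℝ y v * w i (‖y‖^2)) := by
  have h := (hw.deriv i (‖y‖^2)).comp_hasFDerivAt y (hasStrictFDerivAt_norm_sq y).hasFDerivAt
  have h' : fderiv ℝ (fun y : EuclideanSpace ℝ (Fin n) => w (i+1) (‖y‖^2)) y = _ := h.fderiv
  rw [h']
  simp
  ring

lemma Chain.avg_deriv {w : ℕ → ℝ → ℝ} (hw : Chain w) (i : ℕ) (g : EuclideanSpace ℝ (Fin n) → ℝ) (hg : ContDiff ℝ (⊤ : ℕ∞) g)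
    (x : EuclideanSpace ℝ (Fin n)) (R : ℝ) :
    HasDerivAt (fun R : ℝ => ∫ y, w i (‖y‖^2) * g (x + R • y))
      (∫ y, w i (‖y‖^2) * fderiv ℝ g (x + R • y) y) R := by
  have hfc : Continuous (fderiv ℝ g) := hg.continuous_fderiv (by simp)
  have hwc : Continuous (fun y : EuclideanSpace ℝ (Fin n) => w i (‖y‖^2)) := hw.cont_norm i
  have hgc := hg.continuous
  have hΦ : Continuous (fun p : ℝ × EuclideanSpace ℝ (Fin n) =>
      w i (‖p.2‖^2) * fderiv ℝ g (x + p.1 • p.2) p.2) := by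
    refine (hwc.comp continuous_snd).mul ?_
    exact (hfc.comp (by fun_prop)).clm_apply continuous_snd
  obtain ⟨C, hC⟩ := ((isCompact_Icc (a := R-1) (b := R+1)).prod
    (isCompact_closedBall (0 : EuclideanSpace ℝ (Fin n)) 1)).exists_bound_of_continuousOn
    hΦ.continuousOn
  refine (hasDerivAt_integral_of_dominated_loc_of_deriv_le (s := Set.Icc (R-1) (R+1))
    (bound := Set.indicator (closedBall 0 1) (fun _ => C))
    (F' := fun R y => w i (‖y‖^2) * fderiv ℝ g (x + R • y) y)
    (Icc_mem_nhds (by linarith) (by linarith)) ?_ ?_ ?_ ?_ ?_ ?_).2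
  · exact Eventually.of_forall fun r => (hwc.mul (hgc.comp (by fun_prop))).aestronglyMeasurable
  · exact hw.integrable_mul i (hgc.comp (by fun_prop))
  · exact (hwc.mul ((hfc.comp (by fun_prop)).clm_apply continuous_id)).aestronglyMeasurable
  · refine Eventually.of_forall fun y r hr => ?_
    by_cases hy : y ∈ closedBall (0 : EuclideanSpace ℝ (Fin n)) 1
    · rw [Set.indicator_of_mem hy]
      exact hC (r, y) ⟨hr, hy⟩
    · rw [Set.indicator_of_notMem hy]
      have : 1 ≤ ‖y‖ := by simp at hy; exact hy.le
      simp [hw.norm_zero i this]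
  · exact (integrable_indicator_iff measurableSet_closedBall).2
      (integrableOn_const (by exact measure_closedBall_lt_top.ne))
  · refine Eventually.of_forall fun y r _ => ?_
    have h1 : HasDerivAt (fun r : ℝ => x + r • y) y r := by
      simpa using ((hasDerivAt_id r).smul_const y).const_add x
    exact (((hg.differentiable (by simp)) (x + r • y)).hasFDerivAt.comp_hasDerivAt r h1).const_mul _

lemma Chain.ibp {w : ℕ → ℝ → ℝ} (hw : Chain w) (i : ℕ) (g : EuclideanSpace ℝ (Fin n) → ℝ) (hg : ContDiff ℝ (⊤ : ℕ∞) g)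
    (x : EuclideanSpace ℝ (Fin n)) (R : ℝ) :
    ∫ y, w i (‖y‖^2) * fderiv ℝ g (x + R • y) y
      = R * ∫ y, w (i+1) (‖y‖^2) * laplacian g (x + R • y) := by
  have hfc : Continuous (fderiv ℝ g) := hg.continuous_fderiv (by simp)
  set e : Fin n → EuclideanSpace ℝ (Fin n) := fun k => EuclideanSpace.single k 1 with he
  have hGs : ∀ k, ContDiff ℝ (⊤ : ℕ∞) (fun z => fderiv ℝ g z (e k)) := fun k =>
    (hg.fderiv_right (m := (⊤ : ℕ∞)) (by norm_num)).clm_apply contDiff_const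
  have hGc : ∀ k, Continuous (fun y => fderiv ℝ g (x + R • y) (e k)) := fun k =>
    (hGs k).continuous.comp (by fun_prop)
  have hDc : ∀ k, Continuous (fun y => fderiv ℝ (fun z => fderiv ℝ g z (e k)) (x + R • y) (e k)) :=
    fun k => (((hGs k).continuous_fderiv (by simp)).comp (by fun_prop)).clm_apply continuous_const
  have hexp : ∀ y, w i (‖y‖^2) * fderiv ℝ g (x + R • y) y
      = ∑ k, w i (‖y‖^2) * (y k * fderiv ℝ g (x + R • y) (e k)) := by
    intro y
    have hy : y = ∑ k, y k • e k := by
      ext j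
      simp [he, Finset.sum_apply, Pi.single_apply]
    conv_lhs => rw [hy]
    rw [map_sum, ← hy, Finset.mul_sum]
    simp
  have key : ∀ k, ∫ y, w i (‖y‖^2) * (y k * fderiv ℝ g (x + R • y) (e k))
      = R * ∫ y, w (i+1) (‖y‖^2) * fderiv ℝ (fun z => fderiv ℝ g z (e k)) (x + R • y) (e k) := by
    intro k
    have hfG : ∀ y, fderiv ℝ (fun y => fderiv ℝ g (x + R • y) (e k)) y (e k)
        = R * fderiv ℝ (fun z => fderiv ℝ g z (e k)) (x + R • y) (e k) := by
      intro y
      have h1 : HasFDerivAt (fun y : EuclideanSpace ℝ (Fin n) => x + R • y)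
          (R • ContinuousLinearMap.id ℝ _) y := by
        simpa using ((hasFDerivAt_id y).const_smul R).const_add x
      have h2 := (((hGs k).differentiable (by simp)) (x + R • y)).hasFDerivAt.comp y h1
      have h3 : fderiv ℝ (fun y => fderiv ℝ g (x + R • y) (e k)) y = _ := h2.fderiv
      rw [h3]; simp
    have hin : ∀ y : EuclideanSpace ℝ (Fin n), inner ℝ y (e k) = y k := by
      intro y; simp [he, EuclideanSpace.inner_single_right]
    have hI := integral_mul_fderiv_eq_neg_fderiv_mul_of_integrable
      (μ := (volume : Measure (EuclideanSpace ℝ (Fin n))))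
      (f := fun y : EuclideanSpace ℝ (Fin n) => w (i+1) (‖y‖^2))
      (g := fun y => fderiv ℝ g (x + R • y) (e k)) (v := e k) ?_ ?_ ?_ ?_ ?_
    · simp_rw [hfG, hw.fderiv_norm, hin] at hI
      rw [← integral_const_mul]
      calc _ = -∫ y : EuclideanSpace ℝ (Fin n), -(y k * w i (‖y‖^2)) * fderiv ℝ g (x + R • y) (e k) := by
            rw [← integral_neg]; congr 1; ext y; ring
        _ = _ := by rw [← hI]; congr 1; ext y; ring
    · simp_rw [hw.fderiv_norm, hin]
      refine (hw.integrable_mul i (g := fun y => - (y k * fderiv ℝ g (x + R • y) (e k))) ?_).congr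
        (Eventually.of_forall fun y => by simp; ring)
      have := hGc k
      fun_prop
    · simp_rw [hfG]
      exact hw.integrable_mul _ ((hDc k).const_mul R)
    · exact hw.integrable_mul _ (hGc k)
    · exact fun y _ => ((hw.contDiff_norm (i+1)).differentiable (by simp)) y
    · intro y _
      exact (((hGs k).comp (by fun_prop : ContDiff ℝ (⊤ : ℕ∞) (fun y => x + R • y))).differentiable (by simp)) y
  simp_rw [hexp]
  rw [integral_finsetSum _ fun k _ => hw.integrable_mul i (by have := hGc k; fun_prop)]
  simp_rw [key, laplacian_eq g hg, Finset.mul_sum]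
  rw [integral_finsetSum _ fun k _ => hw.integrable_mul (i+1) (hDc k), Finset.mul_sum]

end


lemma taylor_chain (M : ℕ → ℝ → ℝ) (hM : ∀ i R, HasDerivAt (M i) (R * M (i+1) R) R) (k : ℕ) (R : ℝ) :
    M 0 R = ∑ i ∈ Finset.range (k+1), (R^2/2)^i / (i.factorial) * M i 0
      + ∫ r in (0:ℝ)..R, r * ((R^2-r^2)/2)^k / (k.factorial) * M (k+1) r := by
  have hc : ∀ i, Continuous (M i) := fun i =>
    continuous_iff_continuousAt.2 fun R => (hM i R).continuousAt
  induction k with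
  | zero =>
    have := intervalIntegral.integral_eq_sub_of_hasDerivAt (f := M 0) (a := 0) (b := R)
      (fun r _ => hM 0 r) (Continuous.intervalIntegrable (continuous_id.mul (hc 1)) _ _)
    simp [this]
  | succ k ih =>
    rw [Finset.sum_range_succ, ih]
    have h := intervalIntegral.integral_mul_deriv_eq_deriv_mul (a := 0) (b := R)
      (u := M (k+1)) (u' := fun r => r * M (k+2) r)
      (v := fun r => -(((R^2-r^2)/2)^(k+1) / ((k+1).factorial : ℝ)))
      (v' := fun r => r * ((R^2-r^2)/2)^k / (k.factorial : ℝ))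
      (fun r _ => hM (k+1) r) ?_ (Continuous.intervalIntegrable (continuous_id.mul (hc (k+2))) _ _)
      (Continuous.intervalIntegrable (by fun_prop) _ _)
    · have e : ∫ r in (0:ℝ)..R, r * ((R^2-r^2)/2)^k / (k.factorial) * M (k+1) r
          = ∫ r in (0:ℝ)..R, M (k+1) r * (r * ((R^2-r^2)/2)^k / (k.factorial)) := by
        congr 1; ext r; ring
      have e2 : ∫ r in (0:ℝ)..R, r * ((R^2-r^2)/2)^(k+1) / ((k+1).factorial) * M (k+1+1) r
          = - ∫ r in (0:ℝ)..R, r * M (k+2) r * -(((R^2-r^2)/2)^(k+1) / ((k+1).factorial : ℝ)) := by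
        rw [← intervalIntegral.integral_neg]
        congr 1; ext r; ring
      rw [e, h, e2]
      simp
      ring
    · intro r _
      have h1 : HasDerivAt (fun r : ℝ => (R^2 - r^2)/2) (-r) r := by
        have := ((hasDerivAt_pow 2 r).const_sub (R^2)).div_const 2
        refine this.congr_deriv ?_
        push_cast; ring
      refine ((h1.fun_pow (k+1)).div_const ((k+1).factorial : ℝ)).fun_neg.congr_deriv ?_
      rw [Nat.factorial_succ]
      have : (k.factorial : ℝ) ≠ 0 := by positivity
      have : (k + 1 : ℝ) ≠ 0 := by positivity
      push_cast
      field_simp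

lemma exists_weights (m : ℕ) : ∃ a : ℕ → ℝ, ∀ q : Polynomial ℝ, q.degree < m →
    ∑ j ∈ Finset.range m, a j * q.eval (((j:ℝ)+1)^2) = q.eval 0 := by
  refine ⟨fun j => (Lagrange.basis (Finset.range m) (fun j : ℕ => ((j:ℝ)+1)^2) j).eval 0, fun q hq => ?_⟩
  have hinj : Set.InjOn (fun j : ℕ => ((j:ℝ)+1)^2) (Finset.range m) := by
    intro i _ j _ h
    have h' : ((i:ℝ)+1)^2 = ((j:ℝ)+1)^2 := h
    rw [sq_eq_sq₀ (by positivity) (by positivity)] at h'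
    exact_mod_cast (add_right_cancel h')
  have h := Lagrange.eq_interpolate (f := q) hinj (by simpa using hq)
  conv_rhs => rw [h]
  rw [Lagrange.interpolate_apply, Polynomial.eval_finsetSum]
  refine Finset.sum_congr rfl fun j _ => ?_
  simp [mul_comm]

/-- The cutoff weight arising from combining several scales. -/
noncomputable def rhoFn (m : ℕ) (a : ℕ → ℝ) (τ : ℝ) : ℝ :=
  ∑ j ∈ Finset.range m, a j * (if τ < (j:ℝ) + 1 then (1 - ((j:ℝ)+1)^2 / τ^2)^(m-1) else 0)

lemma measurable_rhoFn (m : ℕ) (a : ℕ → ℝ) : Measurable (rhoFn m a) := by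
  unfold rhoFn
  refine Finset.measurable_sum _ fun j _ => ?_
  refine Measurable.const_mul ?_ _
  exact Measurable.ite measurableSet_Iio (by fun_prop) (by fun_prop)

lemma rhoFn_eq_one {m : ℕ} (hm : 1 ≤ m) {a : ℕ → ℝ} (ha : ∀ q : Polynomial ℝ, q.degree < m →
    ∑ j ∈ Finset.range m, a j * q.eval (((j:ℝ)+1)^2) = q.eval 0) {τ : ℝ} (h1 : τ < 1) :
    rhoFn m a τ = 1 := by
  have h := ha ((1 - Polynomial.C (1/τ^2) * Polynomial.X)^(m-1)) ?_
  · simp only [Polynomial.eval_pow, Polynomial.eval_sub, Polynomial.eval_one, Polynomial.eval_mul,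
      Polynomial.eval_C, Polynomial.eval_X, mul_zero, sub_zero, one_pow] at h
    rw [← h]
    unfold rhoFn
    refine Finset.sum_congr rfl fun j _ => ?_
    have : τ < (j:ℝ) + 1 := by have : (0:ℝ) ≤ j := by positivity
                               linarith
    rw [if_pos this]
    congr 2
    ring
  · have h2 : (1 - Polynomial.C (1/τ^2) * Polynomial.X : Polynomial ℝ).natDegree ≤ 1 := by
      compute_degree
    have h3 := Polynomial.natDegree_pow_le_of_le (m-1) h2
    refine lt_of_le_of_lt Polynomial.degree_le_natDegree ?_
    have : ((1 - Polynomial.C (1/τ^2) * Polynomial.X : Polynomial ℝ)^(m-1)).natDegree < m := by omega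
    exact_mod_cast this

lemma rhoFn_bound {m : ℕ} (hm : 1 ≤ m) {a : ℕ → ℝ} (ha : ∀ q : Polynomial ℝ, q.degree < m →
    ∑ j ∈ Finset.range m, a j * q.eval (((j:ℝ)+1)^2) = q.eval 0) :
    ∃ B : ℝ, ∀ τ : ℝ, 0 < τ → |rhoFn m a τ| ≤ B := by
  refine ⟨1 + ∑ j ∈ Finset.range m, |a j| * (((j:ℝ)+1)^2)^(m-1), fun τ hτ => ?_⟩
  have hpos : 0 ≤ ∑ j ∈ Finset.range m, |a j| * (((j:ℝ)+1)^2)^(m-1) :=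
    Finset.sum_nonneg fun j _ => by positivity
  rcases lt_or_ge τ 1 with h | h
  · rw [rhoFn_eq_one hm ha h]; simp; exact hpos
  · have : |rhoFn m a τ| ≤ ∑ j ∈ Finset.range m, |a j| * (((j:ℝ)+1)^2)^(m-1) := by
      unfold rhoFn
      refine (Finset.abs_sum_le_sum_abs _ _).trans (Finset.sum_le_sum fun j _ => ?_)
      rw [abs_mul]
      refine mul_le_mul_of_nonneg_left ?_ (abs_nonneg _)
      split_ifs with hlt
      · rw [abs_pow]
        refine pow_le_pow_left₀ (abs_nonneg _) ?_ _
        have h1 : ((j:ℝ)+1)^2 / τ^2 ≤ ((j:ℝ)+1)^2 := div_le_self (by positivity) (by nlinarith)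
        have h2 : 0 ≤ ((j:ℝ)+1)^2 / τ^2 := by positivity
        have h3 : (1:ℝ) ≤ ((j:ℝ)+1)^2 := by have : (0:ℝ) ≤ j := by positivity
                                            nlinarith
        rw [abs_le]; constructor <;> linarith
      · simp; positivity
    linarith

lemma taylor_comb {m : ℕ} (hm : 1 ≤ m) {a : ℕ → ℝ} (ha : ∀ q : Polynomial ℝ, q.degree < m →
    ∑ j ∈ Finset.range m, a j * q.eval (((j:ℝ)+1)^2) = q.eval 0)
    (M : ℕ → ℝ → ℝ) (hM : ∀ i R, HasDerivAt (M i) (R * M (i+1) R) R) {R : ℝ} (hR : 0 < R) :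
    ∑ j ∈ Finset.range m, a j * M 0 ((j+1) * R) = M 0 0 +
      ∫ r in Set.Ioi (0:ℝ), rhoFn m a (r/R) *
        ((-1)^(m-1) / (2^(m-1) * (m-1).factorial) * r^(2*m-1) * M m r) := by
  have hc : ∀ i, Continuous (M i) := fun i =>
    continuous_iff_continuousAt.2 fun R => (hM i R).continuousAt
  obtain ⟨k, rfl⟩ : ∃ k, m = k + 1 := ⟨m - 1, by omega⟩
  simp only [Nat.add_sub_cancel]
  have h1 : ∀ j : ℕ, M 0 ((j+1) * R) = _ := fun j => taylor_chain M hM k ((j+1) * R)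
  simp_rw [h1, mul_add, Finset.sum_add_distrib]
  congr 1
  · have hP := ha (∑ i ∈ Finset.range (k+1), Polynomial.C ((R^2/2)^i / (i.factorial) * M i 0) * Polynomial.X^i) ?_
    · simp only [Polynomial.eval_finsetSum, Polynomial.eval_mul, Polynomial.eval_C, Polynomial.eval_pow,
        Polynomial.eval_X] at hP
      convert hP using 1
      · refine Finset.sum_congr rfl fun j _ => ?_
        congr 1
        refine Finset.sum_congr rfl fun i _ => ?_
        rw [show (((j:ℝ)+1) * R)^2/2 = R^2/2 * ((j:ℝ)+1)^2 by ring, mul_pow]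
        ring
      · rw [Finset.sum_range_succ']
        simp
    · refine lt_of_le_of_lt (Polynomial.degree_sum_le _ _) ?_
      rw [Finset.sup_lt_iff (by exact_mod_cast WithBot.bot_lt_coe (k+1))]
      intro i hi
      refine lt_of_le_of_lt (Polynomial.degree_C_mul_X_pow_le _ _) ?_
      exact_mod_cast Finset.mem_range.1 hi
  · have hfun : ∀ r : ℝ, rhoFn (k+1) a (r/R) * ((-1)^k / (2^k * k.factorial) * r^(2*(k+1)-1) * M (k+1) r)
        = ∑ j ∈ Finset.range (k+1), a j * ((if r / R < (j:ℝ) + 1 then (1 - ((j:ℝ)+1)^2 / (r/R)^2)^k else 0)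
          * ((-1)^k / (2^k * k.factorial) * r^(2*(k+1)-1) * M (k+1) r)) := by
      intro r
      unfold rhoFn
      rw [Finset.sum_mul]
      refine Finset.sum_congr rfl fun j _ => by rw [Nat.add_sub_cancel]; ring
    have hind : ∀ j : ℕ, ∀ r ∈ Set.Ioi (0:ℝ),
        ((if r / R < (j:ℝ) + 1 then (1 - ((j:ℝ)+1)^2 / (r/R)^2)^k else 0)
          * ((-1)^k / (2^k * k.factorial) * r^(2*(k+1)-1) * M (k+1) r))
        = Set.indicator (Set.Ioo 0 ((j+1)*R))
          (fun r => r * (((((j:ℝ)+1)*R)^2-r^2)/2)^k / (k.factorial) * M (k+1) r) r := by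
      intro j r hr
      have hr' : (0:ℝ) < r := hr
      by_cases hlt : r / R < (j:ℝ) + 1
      · rw [if_pos hlt, Set.indicator_of_mem (show r ∈ Set.Ioo 0 (((j:ℝ)+1)*R) from ⟨hr', (div_lt_iff₀ hR).1 hlt⟩)]
        have : (((((j:ℝ)+1)*R)^2-r^2)/2) = (1 - ((j:ℝ)+1)^2 / (r/R)^2) * (-1) * r^2 / 2 := by
          field_simp; ring
        rw [this]
        generalize (1 - ((j:ℝ)+1)^2 / (r/R)^2) = A
        rw [div_pow, mul_pow, mul_pow, show 2*(k+1)-1 = 2*k+1 by omega, pow_succ, pow_mul]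
        field_simp
      · rw [if_neg hlt, Set.indicator_of_notMem, zero_mul]
        rintro ⟨_, h⟩
        exact hlt ((div_lt_iff₀ hR).2 h)
    have hintg : ∀ j : ℕ, IntegrableOn (fun r => r * (((((j:ℝ)+1)*R)^2-r^2)/2)^k / (k.factorial) * M (k+1) r)
        (Set.Ioo 0 ((j+1)*R)) := by
      intro j
      refine (ContinuousOn.integrableOn_Icc (a := 0) (b := (j+1)*R) ?_).mono_set Set.Ioo_subset_Icc_self
      have := hc (k+1)
      exact Continuous.continuousOn (by fun_prop)
    rw [show 2*k+2*1-1 = 2*(k+1)-1 by omega]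
    simp_rw [hfun]
    rw [integral_finsetSum]
    · refine Finset.sum_congr rfl fun j _ => ?_
      rw [integral_const_mul, setIntegral_congr_fun measurableSet_Ioi (hind j),
        setIntegral_indicator measurableSet_Ioo, intervalIntegral.integral_of_le (by positivity),
        integral_Ioc_eq_integral_Ioo]
      congr 3
      ext r; simp
    · intro j _
      refine Integrable.const_mul ?_ _
      refine (integrableOn_congr_fun (hind j) measurableSet_Ioi).2 ?_
      exact (((integrable_indicator_iff measurableSet_Ioo).2 (hintg j))).integrableOn


section
variable {n : ℕ}

lemma scale_integral (φ : ℝ → ℝ) (F : EuclideanSpace ℝ (Fin n) → ℝ) (x : EuclideanSpace ℝ (Fin n))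
    {r : ℝ} (hr : 0 < r) :
    ∫ y, φ (‖y‖^2) * F (x + r • y) = (r^n)⁻¹ * ∫ y, φ (‖y - x‖^2 / r^2) * F y := by
  have h1 : ∫ y, φ (‖y - x‖^2 / r^2) * F y = ∫ y, φ (‖y‖^2 / r^2) * F (x + y) := by
    rw [← integral_add_left_eq_self _ x]
    simp
  have h2 := Measure.integral_comp_smul (volume : Measure (EuclideanSpace ℝ (Fin n)))
    (fun y => φ (‖y‖^2 / r^2) * F (x + y)) r
  rw [h1, ← show |(r^n)⁻¹| = (r^n)⁻¹ from abs_of_pos (by positivity)]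
  rw [finrank_euclideanSpace_fin, smul_eq_mul] at h2
  rw [← h2]
  congr 1; ext y
  congr 2
  rw [norm_smul, Real.norm_eq_abs, abs_of_pos hr]
  field_simp

/-- The smoothed averages of iterated Laplacians. -/
noncomputable def Mfn (w : ℕ → ℝ → ℝ) (u : EuclideanSpace ℝ (Fin n) → ℝ)
    (x : EuclideanSpace ℝ (Fin n)) (i : ℕ) (R : ℝ) : ℝ :=
  (-1)^i * ∫ y : EuclideanSpace ℝ (Fin n), w i (‖y‖^2) * negLapIter i u (x + R • y)

lemma Mfn_deriv {w : ℕ → ℝ → ℝ} (hw : Chain w) (u : EuclideanSpace ℝ (Fin n) → ℝ)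
    (hu : ContDiff ℝ (⊤ : ℕ∞) u) (x : EuclideanSpace ℝ (Fin n)) (i : ℕ) (R : ℝ) :
    HasDerivAt (Mfn w u x i) (R * Mfn w u x (i+1) R) R := by
  have h := (hw.avg_deriv i _ (contDiff_negLapIter u hu i) x R).const_mul ((-1:ℝ)^i)
  refine h.congr_deriv ?_
  rw [hw.ibp i _ (contDiff_negLapIter u hu i)]
  unfold Mfn
  simp_rw [negLapIter_succ, mul_neg]
  rw [integral_neg]
  ring

lemma Mfn_zero_zero (w : ℕ → ℝ → ℝ) (u : EuclideanSpace ℝ (Fin n) → ℝ)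
    (x : EuclideanSpace ℝ (Fin n)) :
    Mfn w u x 0 0 = u x * ∫ y : EuclideanSpace ℝ (Fin n), w 0 (‖y‖^2) := by
  simp only [Mfn, negLapIter, pow_zero, one_mul, zero_smul, add_zero, Function.iterate_zero, id]
  rw [integral_mul_const, mul_comm]

lemma rep_formula {m : ℕ} (hm : 1 ≤ m) (hn : n = 2 * m) {w : ℕ → ℝ → ℝ} (hw : Chain w)
    {a : ℕ → ℝ} (ha : ∀ q : Polynomial ℝ, q.degree < m →
    ∑ j ∈ Finset.range m, a j * q.eval (((j:ℝ)+1)^2) = q.eval 0)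
    (u f : EuclideanSpace ℝ (Fin n) → ℝ) (hu : ContDiff ℝ (⊤ : ℕ∞) u)
    (hPDE : ∀ x, negLapIter m u x = 2 * f x) (x : EuclideanSpace ℝ (Fin n)) {R : ℝ} (hR : 0 < R) :
    (u x - u 0) * (∫ y : EuclideanSpace ℝ (Fin n), w 0 (‖y‖^2)) =
      ∑ j ∈ Finset.range m, a j * (Mfn w u x 0 ((j+1) * R) - Mfn w u 0 0 ((j+1) * R))
      + 2 / (2^(m-1) * (m-1).factorial) *
        ∫ r in Set.Ioi (0:ℝ), rhoFn m a (r/R) * (r⁻¹ * ((∫ y, w m (‖y - x‖^2 / r^2) * f y) - ∫ y, w m (‖y - 0‖^2 / r^2) * f y)) := by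
  have h := taylor_comb hm ha (fun i R => Mfn w u x i R - Mfn w u 0 i R)
    (fun i R => ((Mfn_deriv hw u hu x i R).sub (Mfn_deriv hw u hu 0 i R)).congr_deriv (by ring)) hR
  rw [h, Mfn_zero_zero, Mfn_zero_zero]
  have key : ∫ r in Set.Ioi (0:ℝ), rhoFn m a (r/R) *
      ((-1)^(m-1)/(2^(m-1)*(m-1).factorial) * r^(2*m-1) * (Mfn w u x m r - Mfn w u 0 m r)) =
      ∫ r in Set.Ioi (0:ℝ), (-(2 / (2^(m-1) * (m-1).factorial))) *
        (rhoFn m a (r/R) * (r⁻¹ * ((∫ y, w m (‖y - x‖^2 / r^2) * f y) - ∫ y, w m (‖y - 0‖^2 / r^2) * f y))) := by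
    refine setIntegral_congr_fun measurableSet_Ioi fun r hr => ?_
    have hr' : (0:ℝ) < r := hr
    have e1 : ∀ x, Mfn w u x m r = (-1)^m * ((r^n)⁻¹ * (2 * ∫ y, w m (‖y - x‖^2 / r^2) * f y)) := by
      intro x
      unfold Mfn
      rw [scale_integral (w m) _ x hr']
      have e0 : ∫ y, w m (‖y - x‖^2 / r^2) * negLapIter m u y =
          2 * ∫ y, w m (‖y - x‖^2 / r^2) * f y := by
        rw [← integral_const_mul]
        refine integral_congr_ae (Eventually.of_forall fun y => ?_)
        simp only [hPDE]
        ring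
      rw [e0]
    have e2 : r^(2*m-1) * (r^n)⁻¹ = r⁻¹ := by
      rw [hn]
      obtain ⟨k, rfl⟩ : ∃ k, m = k + 1 := ⟨m-1, by omega⟩
      rw [show 2*(k+1) = (2*(k+1)-1)+1 by omega, pow_succ, mul_inv, Nat.add_sub_cancel]
      field_simp
    have e3 : (-1:ℝ)^(m-1) * (-1)^m = -1 := by
      obtain ⟨k, rfl⟩ : ∃ k, m = k + 1 := ⟨m-1, by omega⟩
      rw [Nat.add_sub_cancel, pow_succ, ← mul_assoc, ← mul_pow]; norm_num
    show rhoFn m a (r/R) * ((-1)^(m-1)/(2^(m-1)*(m-1).factorial) * r^(2*m-1) * (Mfn w u x m r - Mfn w u 0 m r)) = _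
    rw [e1, e1]
    calc _ = rhoFn m a (r/R) * (((-1:ℝ)^(m-1) * (-1)^m) / (2^(m-1)*(m-1).factorial) *
          (r^(2*m-1) * (r^n)⁻¹) * (2 * ((∫ y, w m (‖y - x‖^2 / r^2) * f y) - ∫ y, w m (‖y - 0‖^2 / r^2) * f y))) := by ring
      _ = _ := by rw [e2, e3]; ring
  rw [key, integral_const_mul]
  ring
end


lemma frullani_le {φ : ℝ → ℝ} (hc : Continuous φ) (ha : Antitone φ) (h0 : ∀ ξ, 0 ≤ φ ξ)
    (h1 : ∀ ξ, 1 ≤ ξ → φ ξ = 0) {a b : ℝ} (hapos : 0 < a) (hab : a ≤ b) :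
    IntegrableOn (fun r => r⁻¹ * (φ (a^2/r^2) - φ (b^2/r^2))) (Set.Ioi 0) ∧
    ∫ r in Set.Ioi (0:ℝ), r⁻¹ * (φ (a^2/r^2) - φ (b^2/r^2)) = φ 0 * log (b/a) := by
  have hbpos : 0 < b := hapos.trans_le hab
  set ψ : ℝ → ℝ := fun τ => φ ((τ⁻¹)^2) * τ⁻¹ with hψ
  have hψc : ∀ τ, 0 < τ → ContinuousAt ψ τ := by
    intro τ hτ
    have : ContinuousAt (fun τ : ℝ => τ⁻¹) τ := continuousAt_inv₀ hτ.ne'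
    exact (hc.continuousAt.comp (this.pow 2)).mul this
  have hψm : Measurable ψ := by
    have := hc.measurable
    fun_prop
  have hψi : ∀ s t, 0 < s → 0 < t → IntervalIntegrable ψ volume s t := by
    intro s t hs ht
    refine ContinuousOn.intervalIntegrable fun τ hτ => (hψc τ ?_).continuousWithinAt
    exact (lt_min hs ht).trans_le hτ.1
  set Φ : ℝ → ℝ := fun t => ∫ τ in (1:ℝ)..t, ψ τ with hΦ
  have hΦd : ∀ t, 0 < t → HasDerivAt Φ (ψ t) t := fun t ht =>
    intervalIntegral.integral_hasDerivAt_right (hψi 1 t one_pos ht)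
      (hψm.stronglyMeasurable.stronglyMeasurableAtFilter) (hψc t ht)
  have hΦ0 : ∀ t, 0 < t → t ≤ 1 → Φ t = 0 := by
    intro t ht ht1
    show ∫ τ in (1:ℝ)..t, ψ τ = 0
    rw [intervalIntegral.integral_congr (g := fun _ => (0:ℝ))]
    · simp
    · intro τ hτ
      rw [Set.uIcc_of_ge ht1] at hτ
      have hτ0 : 0 < τ := ht.trans_le hτ.1
      have : 1 ≤ (τ⁻¹)^2 := by
        have := (one_le_inv₀ hτ0).2 hτ.2
        nlinarith
      show φ ((τ⁻¹)^2) * τ⁻¹ = 0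
      rw [h1 _ this, zero_mul]
  have hcont : ContinuousWithinAt (fun r => Φ (r/a) - Φ (r/b)) (Set.Ici 0) 0 := by
    have he : (fun r => Φ (r/a) - Φ (r/b)) =ᶠ[𝓝[Set.Ici 0] 0] fun _ => 0 := by
      have : Set.Ico (0:ℝ) a ∈ 𝓝[Set.Ici 0] 0 := Ico_mem_nhdsGE hapos
      filter_upwards [this] with r hr
      rcases hr.1.eq_or_lt with h | h
      · simp [← h]
      · rw [hΦ0 _ (by positivity) ((div_le_one hapos).2 hr.2.le),
          hΦ0 _ (by positivity) ((div_le_one hbpos).2 (hr.2.le.trans hab)), sub_zero]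
    exact (continuousWithinAt_const (b := (0:ℝ))).congr_of_eventuallyEq he (by simp)
  have hder : ∀ r ∈ Set.Ioi (0:ℝ), HasDerivAt (fun r => Φ (r/a) - Φ (r/b))
      (r⁻¹ * (φ (a^2/r^2) - φ (b^2/r^2))) r := by
    intro r hr
    have hr' : (0:ℝ) < r := hr
    have e1 := (hΦd (r/a) (by positivity)).comp r ((hasDerivAt_id r).div_const a)
    have e2 := (hΦd (r/b) (by positivity)).comp r ((hasDerivAt_id r).div_const b)
    refine (e1.sub e2).congr_deriv ?_
    simp only [hψ, inv_div, div_pow]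
    field_simp
  have hnn : ∀ r ∈ Set.Ioi (0:ℝ), 0 ≤ r⁻¹ * (φ (a^2/r^2) - φ (b^2/r^2)) := by
    intro r hr
    have hr' : (0:ℝ) < r := hr
    refine mul_nonneg (by positivity) (sub_nonneg.2 (ha ?_))
    gcongr
  have hlim : Tendsto (fun r => Φ (r/a) - Φ (r/b)) atTop (𝓝 (φ 0 * log (b/a))) := by
    have hl : ∀ c : ℝ, Tendsto (fun r : ℝ => φ ((c/r)^2) * log (b/a)) atTop (𝓝 (φ 0 * log (b/a))) := by
      intro c
      have : Tendsto (fun r : ℝ => (c/r)^2) atTop (𝓝 0) := by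
        have h := (tendsto_const_nhds (x := c)).div_atTop (tendsto_id (α := ℝ) (x := atTop))
        simpa using h.pow 2
      exact ((hc.tendsto 0).comp this).mul_const _
    have hbetween : ∀ r : ℝ, 0 < r → φ ((b/r)^2) * log (b/a) ≤ Φ (r/a) - Φ (r/b) ∧
        Φ (r/a) - Φ (r/b) ≤ φ ((a/r)^2) * log (b/a) := by
      intro r hr
      have hra : 0 < r / a := by positivity
      have hrb : 0 < r / b := by positivity
      have hle : r / b ≤ r / a := by gcongr
      have e : Φ (r/a) - Φ (r/b) = ∫ τ in (r/b)..(r/a), ψ τ := by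
        rw [intervalIntegral.integral_interval_sub_left (hψi _ _ one_pos hra) (hψi _ _ one_pos hrb)]
      have el : log (b/a) = ∫ τ in (r/b)..(r/a), τ⁻¹ := by
        rw [integral_inv_of_pos hrb hra]
        congr 1
        field_simp
      have hinv : IntervalIntegrable (fun τ : ℝ => τ⁻¹) volume (r/b) (r/a) := by
        refine ContinuousOn.intervalIntegrable fun τ hτ => (continuousAt_inv₀ ?_).continuousWithinAt
        exact ((lt_min hrb hra).trans_le hτ.1).ne'
      rw [e, el, ← intervalIntegral.integral_const_mul, ← intervalIntegral.integral_const_mul]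
      constructor
      · refine intervalIntegral.integral_mono_on hle (hinv.const_mul _) (hψi _ _ hrb hra) fun τ hτ => ?_
        have hτ0 : 0 < τ := hrb.trans_le hτ.1
        refine mul_le_mul_of_nonneg_right (ha ?_) (by positivity)
        have : τ⁻¹ ≤ b / r := by
          rw [← inv_div]; exact inv_anti₀ hrb hτ.1
        gcongr
      · refine intervalIntegral.integral_mono_on hle (hψi _ _ hrb hra) (hinv.const_mul _) fun τ hτ => ?_
        have hτ0 : 0 < τ := hrb.trans_le hτ.1
        refine mul_le_mul_of_nonneg_right (ha ?_) (by positivity)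
        have : a / r ≤ τ⁻¹ := by
          rw [← inv_div]; exact inv_anti₀ hτ0 hτ.2
        gcongr
    refine tendsto_of_tendsto_of_tendsto_of_le_of_le' (hl b) (hl a) ?_ ?_
    · filter_upwards [eventually_gt_atTop 0] with r hr using (hbetween r hr).1
    · filter_upwards [eventually_gt_atTop 0] with r hr using (hbetween r hr).2
  refine ⟨integrableOn_Ioi_deriv_of_nonneg hcont hder hnn hlim, ?_⟩
  rw [integral_Ioi_of_hasDerivAt_of_nonneg hcont hder hnn hlim]
  simp

lemma frullani {φ : ℝ → ℝ} (hc : Continuous φ) (ha : Antitone φ) (h0 : ∀ ξ, 0 ≤ φ ξ)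
    (h1 : ∀ ξ, 1 ≤ ξ → φ ξ = 0) {a b : ℝ} (hapos : 0 < a) (hbpos : 0 < b) :
    IntegrableOn (fun r => r⁻¹ * (φ (a^2/r^2) - φ (b^2/r^2))) (Set.Ioi 0) ∧
    ∫ r in Set.Ioi (0:ℝ), r⁻¹ * (φ (a^2/r^2) - φ (b^2/r^2)) = φ 0 * log (b/a) ∧
    ∫ r in Set.Ioi (0:ℝ), |r⁻¹ * (φ (a^2/r^2) - φ (b^2/r^2))| = φ 0 * |log (b/a)| := by
  have main : ∀ a b : ℝ, 0 < a → a ≤ b → 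
     IntegrableOn (fun r => r⁻¹ * (φ (a^2/r^2) - φ (b^2/r^2))) (Set.Ioi 0) ∧
    ∫ r in Set.Ioi (0:ℝ), r⁻¹ * (φ (a^2/r^2) - φ (b^2/r^2)) = φ 0 * log (b/a) ∧
    ∫ r in Set.Ioi (0:ℝ), |r⁻¹ * (φ (a^2/r^2) - φ (b^2/r^2))| = φ 0 * |log (b/a)| := by
    intro a b ha0 hab
    obtain ⟨e1, e2⟩ := frullani_le hc ha h0 h1 ha0 hab
    refine ⟨e1, e2, ?_⟩
    rw [abs_of_nonneg (log_nonneg ((one_le_div ha0).2 hab)), ← e2]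
    refine setIntegral_congr_fun measurableSet_Ioi fun r hr => abs_of_nonneg ?_
    have hr' : (0:ℝ) < r := hr
    refine mul_nonneg (by positivity) (sub_nonneg.2 (ha ?_))
    gcongr
  rcases le_total a b with h | h
  · exact main a b hapos h
  · obtain ⟨e1, e2, e3⟩ := main b a hbpos h
    have e : ∀ r : ℝ, r⁻¹ * (φ (a^2/r^2) - φ (b^2/r^2)) = -(r⁻¹ * (φ (b^2/r^2) - φ (a^2/r^2))) := by
      intro r; ring
    have el : log (b/a) = - log (a/b) := by rw [← log_inv, inv_div]
    simp_rw [e, abs_neg, integral_neg, e2, e3, el, abs_neg]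
    exact ⟨e1.neg, by ring, trivial⟩


lemma abs_log_le {t : ℝ} (ht : 0 ≤ t) : |log t| ≤ t + t⁻¹ := by
  rcases ht.eq_or_lt with h | h
  · simp [← h]
  · have h1 := log_le_sub_one_of_pos h
    have h2 := log_le_sub_one_of_pos (inv_pos.2 h)
    rw [log_inv] at h2
    have h3 := inv_pos.2 h
    rw [abs_le]; constructor <;> linarith

section
variable {n : ℕ}

lemma locInt_inv (hn : 2 ≤ n) : LocallyIntegrable (fun z : EuclideanSpace ℝ (Fin n) => ‖z‖⁻¹) := by
  refine locallyIntegrable_of_norm_le_rpow (C := 1) (α := 1) ?_ ?_ ?_ ?_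
  · rw [finrank_euclideanSpace_fin]; omega
  · rw [finrank_euclideanSpace_fin]; exact_mod_cast (by omega : 1 < n)
  · refine Eventually.of_forall fun z => ?_
    rw [rpow_neg_one, one_mul, norm_inv, norm_norm]
  · exact (measurable_norm.inv).aestronglyMeasurable

lemma locInt_log (hn : 2 ≤ n) : LocallyIntegrable (fun z : EuclideanSpace ℝ (Fin n) => log ‖z‖) := by
  refine ((continuous_norm.locallyIntegrable).add (locInt_inv hn)).mono ?_ ?_
  · exact (measurable_norm.log).aestronglyMeasurable
  · refine Eventually.of_forall fun z => ?_
    refine (abs_log_le (norm_nonneg z)).trans (le_abs_self _)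

lemma intOn_sub {g : EuclideanSpace ℝ (Fin n) → ℝ} (hg : LocallyIntegrable g)
    (x : EuclideanSpace ℝ (Fin n)) (R : ℝ) :
    IntegrableOn (fun y => g (x - y)) (ball 0 R) := by
  have h1 : IntegrableOn g (ball 0 (R + ‖x‖)) :=
    (hg.integrableOn_isCompact (isCompact_closedBall 0 (R+‖x‖))).mono_set ball_subset_closedBall
  have h2 := ((integrable_indicator_iff measurableSet_ball).2 h1).comp_sub_left x
  refine (h2.integrableOn (s := ball 0 R)).congr_fun ?_ measurableSet_ball
  intro y hy
  have : x - y ∈ ball (0 : EuclideanSpace ℝ (Fin n)) (R + ‖x‖) := by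
    rw [mem_ball_zero_iff] at hy ⊢
    have := norm_sub_le x y
    linarith
  simp only [Set.indicator_of_mem this]

lemma log_ratio_bound {x y : EuclideanSpace ℝ (Fin n)} (h : 2 * ‖x‖ ≤ ‖y‖) :
    |log (‖y‖ / ‖x - y‖)| ≤ log 2 := by
  have hl2 : 0 ≤ log 2 := log_nonneg (by norm_num)
  rcases (norm_nonneg y).eq_or_lt with h0 | h0
  · simp [← h0, hl2]
  · have h1 := norm_sub_norm_le y x
    have h2 := norm_sub_le x y
    rw [norm_sub_rev] at h1
    have h3 : 0 < ‖x - y‖ := by linarith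
    rw [abs_le]
    constructor
    · rw [← log_inv]
      refine log_le_log (by norm_num) ?_
      rw [le_div_iff₀ h3]; linarith [norm_nonneg x]
    · refine log_le_log (by positivity) ?_
      rw [div_le_iff₀ h3]; linarith

lemma integrable_log (hn : 2 ≤ n) {f : EuclideanSpace ℝ (Fin n) → ℝ} (hc : Continuous f)
    (hf : Integrable f) (x : EuclideanSpace ℝ (Fin n)) :
    Integrable (fun y => log (‖y‖ / ‖x - y‖) * f y) := by
  have hm : AEStronglyMeasurable (fun y => log (‖y‖ / ‖x - y‖)) (volume : Measure (EuclideanSpace ℝ (Fin n))) := by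
    apply Measurable.aestronglyMeasurable; fun_prop
  rw [← integrableOn_univ, ← Set.union_compl_self (ball (0 : EuclideanSpace ℝ (Fin n)) (2*‖x‖))]
  refine IntegrableOn.union ?_ ?_
  · obtain ⟨B, hB⟩ := (isCompact_closedBall (0 : EuclideanSpace ℝ (Fin n)) (2*‖x‖)).exists_bound_of_continuousOn hc.continuousOn
    have h1 : IntegrableOn (fun y : EuclideanSpace ℝ (Fin n) => log ‖y‖) (ball 0 (2*‖x‖)) :=
      ((locInt_log hn).integrableOn_isCompact (isCompact_closedBall 0 (2*‖x‖))).mono_set ball_subset_closedBall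
    have h2 := intOn_sub (locInt_log hn) x (2*‖x‖)
    refine Integrable.mono' ((h1.norm.add h2.norm).mul_const B) (hm.mul hc.aestronglyMeasurable).restrict ?_
    filter_upwards [ae_restrict_mem measurableSet_ball] with y hy
    rw [norm_mul]
    refine mul_le_mul ?_ (hB y (ball_subset_closedBall hy)) (norm_nonneg _) (add_nonneg (norm_nonneg _) (norm_nonneg _))
    simp only [Pi.add_apply]
    by_cases hy0 : ‖y‖ = 0
    · rw [hy0]; simp
    by_cases hx0 : ‖x - y‖ = 0
    · rw [hx0]; simp
    · rw [log_div hy0 hx0]; exact norm_sub_le _ _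
  · refine Integrable.mono' (hf.norm.integrableOn.const_mul (log 2)) (hm.mul hc.aestronglyMeasurable).restrict ?_
    filter_upwards [ae_restrict_mem measurableSet_ball.compl] with y hy
    rw [norm_mul]
    refine mul_le_mul_of_nonneg_right ?_ (norm_nonneg _)
    refine log_ratio_bound ?_
    simpa using hy
end


section
variable {n : ℕ}

lemma kernel_integrable (hn : 2 ≤ n) {φ : ℝ → ℝ} (hφc : Continuous φ) (hφa : Antitone φ)
    (h0 : ∀ ξ, 0 ≤ φ ξ) (h1 : ∀ ξ, 1 ≤ ξ → φ ξ = 0)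
    {f : EuclideanSpace ℝ (Fin n) → ℝ} (hc : Continuous f)
    (hf : Integrable f) (x : EuclideanSpace ℝ (Fin n)) :
    Integrable (fun p : ℝ × EuclideanSpace ℝ (Fin n) =>
      p.1⁻¹ * (φ (‖p.2 - x‖^2/p.1^2) - φ (‖p.2‖^2/p.1^2)) * f p.2)
      ((volume.restrict (Set.Ioi 0)).prod volume) ∧
    (∀ᵐ y : EuclideanSpace ℝ (Fin n), ∫ r in Set.Ioi (0:ℝ), r⁻¹ * (φ (‖y - x‖^2/r^2) - φ (‖y‖^2/r^2)) * f y
      = φ 0 * (log (‖y‖/‖x - y‖) * f y)) := by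
  have : Nontrivial (EuclideanSpace ℝ (Fin n)) :=
    Module.nontrivial_of_finrank_pos (R := ℝ) (by rw [finrank_euclideanSpace_fin]; omega)
  have hae : ∀ᵐ y : EuclideanSpace ℝ (Fin n), 0 < ‖y‖ ∧ 0 < ‖y - x‖ := by
    have a1 : ∀ᵐ y : EuclideanSpace ℝ (Fin n), y ≠ 0 := by simp [ae_iff]
    have a2 : ∀ᵐ y : EuclideanSpace ℝ (Fin n), y ≠ x := by simp [ae_iff]
    filter_upwards [a1, a2] with y h1 h2
    exact ⟨norm_pos_iff.2 h1, norm_pos_iff.2 (sub_ne_zero.2 h2)⟩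
  have hφm := hφc.measurable
  constructor
  · rw [integrable_prod_iff']
    · constructor
      · filter_upwards [hae] with y hy
        exact (frullani hφc hφa h0 h1 hy.2 hy.1).1.mul_const _
      · refine ((integrable_log hn hc hf x).norm.const_mul (φ 0)).congr ?_
        filter_upwards [hae] with y hy
        have e : ∀ r : ℝ, ‖r⁻¹ * (φ (‖y - x‖^2/r^2) - φ (‖y‖^2/r^2)) * f y‖ =
            |r⁻¹ * (φ (‖y - x‖^2/r^2) - φ (‖y‖^2/r^2))| * ‖f y‖ := fun r => norm_mul _ _
        simp_rw [e]
        rw [integral_mul_const, (frullani hφc hφa h0 h1 hy.2 hy.1).2.2, norm_sub_rev x y, norm_mul,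
          Real.norm_eq_abs]
        ring
    · have := hc.measurable
      apply Measurable.aestronglyMeasurable; fun_prop
  · filter_upwards [hae] with y hy
    rw [integral_mul_const, (frullani hφc hφa h0 h1 hy.2 hy.1).2.1, norm_sub_rev x y]
    ring

lemma limit_rep (hn : 2 ≤ n) {φ : ℝ → ℝ} (hφc : Continuous φ) (hφa : Antitone φ)
    (h0 : ∀ ξ, 0 ≤ φ ξ) (h1 : ∀ ξ, 1 ≤ ξ → φ ξ = 0)
    {f : EuclideanSpace ℝ (Fin n) → ℝ} (hc : Continuous f)
    (hf : Integrable f) (x : EuclideanSpace ℝ (Fin n)) {ρ : ℝ → ℝ} (hρm : Measurable ρ)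
    (hρ1 : ∀ τ < 1, ρ τ = 1) {B : ℝ} (hρB : ∀ τ, 0 < τ → |ρ τ| ≤ B) :
    Tendsto (fun R => ∫ r in Set.Ioi (0:ℝ), ρ (r/R) *
      (r⁻¹ * ((∫ y, φ (‖y - x‖^2 / r^2) * f y) - ∫ y, φ (‖y - 0‖^2 / r^2) * f y)))
      atTop (𝓝 (φ 0 * ∫ y, log (‖y‖/‖x - y‖) * f y)) := by
  obtain ⟨hi, he⟩ := kernel_integrable hn hφc hφa h0 h1 hc hf x
  have hφi : ∀ (x : EuclideanSpace ℝ (Fin n)) (r : ℝ), Integrable (fun y => φ (‖y - x‖^2 / r^2) * f y) := by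
    intro x r
    refine hf.bdd_mul (c := φ 0) ?_ (Eventually.of_forall fun y => ?_)
    · refine Continuous.aestronglyMeasurable ?_
      fun_prop
    · rw [Real.norm_eq_abs, abs_of_nonneg (h0 _)]
      exact hφa (by positivity)
  set G : ℝ → ℝ := fun r => (r⁻¹ * ((∫ y, φ (‖y - x‖^2 / r^2) * f y) - ∫ y, φ (‖y - 0‖^2 / r^2) * f y)) with hG
  have hGe : ∀ r, G r = ∫ y, r⁻¹ * (φ (‖y - x‖^2/r^2) - φ (‖y‖^2/r^2)) * f y := by
    intro r
    simp only [hG]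
    rw [← integral_sub (hφi _ _) (hφi _ _), ← integral_const_mul]
    refine integral_congr_ae (Eventually.of_forall fun y => ?_)
    simp only [sub_zero]
    ring
  have hGi : Integrable G (volume.restrict (Set.Ioi 0)) := by
    refine hi.integral_prod_left.congr (Eventually.of_forall fun r => ?_)
    exact (hGe r).symm
  have hlim : ∫ r in Set.Ioi (0:ℝ), G r = φ 0 * ∫ y, log (‖y‖/‖x - y‖) * f y := by
    rw [← integral_const_mul]
    simp_rw [hGe]
    rw [integral_integral_swap hi]
    exact integral_congr_ae he
  rw [← hlim]
  refine tendsto_integral_filter_of_dominated_convergence (fun r => B * ‖G r‖) ?_ ?_ (hGi.norm.const_mul B) ?_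
  · refine Eventually.of_forall fun R => ?_
    refine AEStronglyMeasurable.mul ?_ hGi.1
    exact (hρm.comp (measurable_id.div_const R)).aestronglyMeasurable
  · filter_upwards [eventually_gt_atTop 0] with R hR
    filter_upwards [ae_restrict_mem measurableSet_Ioi] with r hr
    rw [norm_mul]
    exact mul_le_mul_of_nonneg_right (hρB _ (div_pos hr hR)) (norm_nonneg _)
  · filter_upwards [ae_restrict_mem measurableSet_Ioi] with r hr
    refine tendsto_const_nhds.congr' ?_
    filter_upwards [eventually_gt_atTop r] with R hR
    rw [hρ1 _ ((div_lt_one (lt_trans hr hR)).2 hR), one_mul]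

/-- The normalised potential. -/
noncomputable def Npot (f : EuclideanSpace ℝ (Fin n) → ℝ) (x : EuclideanSpace ℝ (Fin n)) : ℝ :=
  (1 / cconst n) * ∫ y, log (‖y‖ / ‖x - y‖) * f y

lemma cconst_pos (n : ℕ) : 0 < cconst n := by
  unfold cconst; positivity

/-- Convergence of the averaged differences to `u x - u 0 - N x`. -/
lemma limit_H {m : ℕ} (hm : 1 ≤ m) (hn : n = 2 * m) {w : ℕ → ℝ → ℝ} (hw : Chain w)
    {a : ℕ → ℝ} (ha : ∀ q : Polynomial ℝ, q.degree < m →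
    ∑ j ∈ Finset.range m, a j * q.eval (((j:ℝ)+1)^2) = q.eval 0)
    (u f : EuclideanSpace ℝ (Fin n) → ℝ) (hu : ContDiff ℝ (⊤ : ℕ∞) u) (hfc : Continuous f)
    (hf : Integrable f)
    (hPDE : ∀ x, negLapIter m u x = 2 * f x) (x : EuclideanSpace ℝ (Fin n)) :
    Tendsto (fun R : ℝ => ∑ j ∈ Finset.range m, a j * (Mfn w u x 0 ((j+1) * R) - Mfn w u 0 0 ((j+1) * R)))
      atTop (𝓝 ((∫ y : EuclideanSpace ℝ (Fin n), w 0 (‖y‖^2)) * (u x - u 0 - Npot f x))) := by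
  obtain ⟨B, hB⟩ := rhoFn_bound hm ha
  obtain ⟨k, rfl⟩ : ∃ k, m = k + 1 := ⟨m-1, by omega⟩
  have h := limit_rep (by omega) (hw.smooth (k+1)).continuous (hw.antitone k) (hw.nonneg (k+1)) (hw.zero (k+1))
    hfc hf x (measurable_rhoFn _ a) (fun τ hτ => rhoFn_eq_one hm ha hτ) hB
  have h2 := (tendsto_const_nhds (x := (u x - u 0) * (∫ y : EuclideanSpace ℝ (Fin n), w 0 (‖y‖^2)))).sub
    (h.const_mul ((2:ℝ) / (2^(k+1-1) * ((k+1-1).factorial : ℝ))))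
  have e : (u x - u 0) * (∫ y : EuclideanSpace ℝ (Fin n), w 0 (‖y‖^2)) -
      2 / (2^(k+1-1) * (k+1-1).factorial) * (w (k+1) 0 * ∫ y, log (‖y‖/‖x - y‖) * f y) =
      ((∫ y : EuclideanSpace ℝ (Fin n), w 0 (‖y‖^2)) * (u x - u 0 - Npot f x)) := by
    rw [hw.total hm hn]
    unfold Npot cconst
    subst hn
    rw [show 2 * (k+1) - 2 = 2 * k by omega, show 2 * k / 2 = k by omega,
      show 2 * (k+1) / 2 = k + 1 by omega, Nat.add_sub_cancel]
    have : (Nat.factorial k : ℝ) ≠ 0 := by positivity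
    field_simp
    ring
  rw [e] at h2
  refine h2.congr' ?_
  filter_upwards [eventually_gt_atTop 0] with R hR
  rw [rep_formula hm hn hw ha u f hu hPDE x hR]
  ring
end


section
variable {n : ℕ}

lemma exp_integrable (u Q : EuclideanSpace ℝ (Fin n) → ℝ) (hu : Continuous u)
    (hf : MeasureTheory.Integrable (fun y => Q y * Real.exp (n * u y)))
    (hQ : ∀ δ > (0 : ℝ), ∃ Rδ : ℝ, ∀ x : EuclideanSpace ℝ (Fin n), Rδ ≤ ‖x‖ →
      Real.exp (-δ * ‖x‖ ^ 2) ≤ Q x) {δ : ℝ} (hδ : 0 < δ) :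
    Integrable (fun x : EuclideanSpace ℝ (Fin n) => exp (n * u x - δ * ‖x‖^2)) := by
  obtain ⟨R, hR⟩ := hQ δ hδ
  have hc : Continuous (fun x : EuclideanSpace ℝ (Fin n) => exp (n * u x - δ * ‖x‖^2)) := by fun_prop
  rw [← integrableOn_univ, ← Set.union_compl_self (closedBall (0 : EuclideanSpace ℝ (Fin n)) R)]
  refine IntegrableOn.union (hc.continuousOn.integrableOn_compact (isCompact_closedBall _ _)) ?_
  refine Integrable.mono' hf.integrableOn hc.aestronglyMeasurable.restrict ?_
  filter_upwards [ae_restrict_mem measurableSet_closedBall.compl] with y hy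
  have hy' : R ≤ ‖y‖ := by
    simp at hy; exact hy.le
  rw [norm_eq_abs, abs_of_pos (exp_pos _), sub_eq_add_neg, add_comm, exp_add]
  have := hR y hy'
  rw [neg_mul] at this
  exact mul_le_mul_of_nonneg_right this (exp_pos _).le

lemma Chain.bdd {w : ℕ → ℝ → ℝ} (hw : Chain w) (i : ℕ) : ∃ K, ∀ ξ, 0 ≤ ξ → w i ξ ≤ K := by
  obtain ⟨K, hK⟩ := (isCompact_Icc (a := (0:ℝ)) (b := 1)).exists_bound_of_continuousOn (hw.smooth i).continuous.continuousOn
  refine ⟨K, fun ξ hξ => ?_⟩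
  rcases le_or_gt ξ 1 with h | h
  · exact (le_abs_self _).trans (hK ξ ⟨hξ, h⟩)
  · rw [hw.zero i ξ h.le]
    exact (norm_nonneg _).trans (hK 0 ⟨le_rfl, zero_le_one⟩)

lemma posPart_bound {w : ℕ → ℝ → ℝ} (hw : Chain w) (hn : 1 ≤ n) (u : EuclideanSpace ℝ (Fin n) → ℝ) (hu : Continuous u)
    (hexp : Integrable (fun x : EuclideanSpace ℝ (Fin n) => exp (n * u x - 1 * ‖x‖^2))) :
    ∃ C, ∀ R : ℝ, 1 ≤ R → ∫ y : EuclideanSpace ℝ (Fin n), w 0 (‖y‖^2) * max (u (R • y)) 0 ≤ C * R^2 := by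
  obtain ⟨K, hK⟩ := hw.bdd 0
  have hK0 : 0 ≤ K := (hw.nonneg 0 0).trans (hK 0 le_rfl)
  set J := ∫ x : EuclideanSpace ℝ (Fin n), exp (n * u x - 1 * ‖x‖^2)
  have hJ : 0 ≤ J := integral_nonneg fun x => (exp_pos _).le
  set I := ∫ y : EuclideanSpace ℝ (Fin n), w 0 (‖y‖^2) * ‖y‖^2
  refine ⟨K * J + I, fun R hR => ?_⟩
  have hRn : (R^n)⁻¹ ≤ 1 := inv_le_one_of_one_le₀ (one_le_pow₀ hR)
  have hRpos : 0 < R := by linarith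
  have i1 : Integrable (fun y : EuclideanSpace ℝ (Fin n) => exp (n * u (R • y) - 1 * ‖R • y‖^2)) :=
    hexp.comp_smul hRpos.ne'
  have i2 : Integrable (fun y : EuclideanSpace ℝ (Fin n) => w 0 (‖y‖^2) * ‖y‖^2) :=
    hw.integrable_mul 0 (by fun_prop)
  have e1 : ∫ y : EuclideanSpace ℝ (Fin n), exp (n * u (R • y) - 1 * ‖R • y‖^2) = (R^n)⁻¹ * J := by
    have := Measure.integral_comp_smul (volume : Measure (EuclideanSpace ℝ (Fin n)))
      (fun x => exp (n * u x - 1 * ‖x‖^2)) R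
    rw [this, finrank_euclideanSpace_fin, smul_eq_mul, abs_of_pos (by positivity)]
  calc ∫ y : EuclideanSpace ℝ (Fin n), w 0 (‖y‖^2) * max (u (R • y)) 0
      ≤ ∫ y : EuclideanSpace ℝ (Fin n), (K * exp (n * u (R • y) - 1 * ‖R • y‖^2) + R^2 * (w 0 (‖y‖^2) * ‖y‖^2)) := by
        refine integral_mono (hw.integrable_mul 0 (by fun_prop)) ((i1.const_mul K).add (i2.const_mul _)) fun y => ?_
        have hb : max (u (R • y)) 0 ≤ exp (n * u (R • y) - 1 * ‖R • y‖^2) + ‖R • y‖^2 := by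
          refine max_le ?_ (by positivity)
          rcases le_or_gt (u (R • y)) 0 with h | h
          · refine h.trans (by positivity)
          · have := add_one_le_exp (n * u (R • y) - 1 * ‖R • y‖^2)
            have hn' : (1:ℝ) ≤ n := by exact_mod_cast hn
            nlinarith
        have hw0 := hw.nonneg 0 (‖y‖^2)
        have hwK := hK (‖y‖^2) (by positivity)
        calc w 0 (‖y‖^2) * max (u (R • y)) 0 ≤ w 0 (‖y‖^2) * (exp (n * u (R • y) - 1 * ‖R • y‖^2) + ‖R • y‖^2) :=
              mul_le_mul_of_nonneg_left hb hw0
          _ = w 0 (‖y‖^2) * exp (n * u (R • y) - 1 * ‖R • y‖^2) + R^2 * (w 0 (‖y‖^2) * ‖y‖^2) := by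
              rw [norm_smul, norm_eq_abs, mul_pow, sq_abs]; ring
          _ ≤ _ := by gcongr
    _ = K * ((R^n)⁻¹ * J) + R^2 * I := by
        rw [integral_add (i1.const_mul K) (i2.const_mul _), integral_const_mul, integral_const_mul, e1]
    _ ≤ (K * J + I) * R^2 := by
        have h1 : (R^n)⁻¹ * J ≤ J := mul_le_of_le_one_left hJ hRn
        have h2 : K * ((R^n)⁻¹ * J) ≤ K * J := mul_le_mul_of_nonneg_left h1 hK0
        have h3 : K * J ≤ K * J * R^2 := le_mul_of_one_le_right (by positivity) (one_le_pow₀ hR)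
        linarith

lemma Mfn_bound {m : ℕ} (hm : 1 ≤ m) {w : ℕ → ℝ → ℝ} (hw : Chain w)
    (u f : EuclideanSpace ℝ (Fin n) → ℝ) (hu : ContDiff ℝ (⊤ : ℕ∞) u)
    (hf : Integrable f)
    (hPDE : ∀ x, negLapIter m u x = 2 * f x) :
    ∃ C, ∀ R : ℝ, 1 ≤ R → |Mfn w u 0 0 R| ≤ C * R^(2*m) := by
  obtain ⟨k, rfl⟩ : ∃ k, m = k + 1 := ⟨m-1, by omega⟩
  obtain ⟨K, hK⟩ := hw.bdd (k+1)
  have hcont : Continuous (Mfn w u 0 (k+1)) := continuous_iff_continuousAt.2 fun R => (Mfn_deriv hw u hu 0 (k+1) R).continuousAt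
  obtain ⟨B1, hB1⟩ := (isCompact_Icc (a := (0:ℝ)) (b := 1)).exists_bound_of_continuousOn hcont.continuousOn
  set B2 := 2 * (K * ∫ y, ‖f y‖) with hB2
  have hK0 : 0 ≤ K := (hw.nonneg (k+1) 0).trans (hK 0 le_rfl)
  have hB20 : 0 ≤ B2 := by
    have : 0 ≤ ∫ y, ‖f y‖ := integral_nonneg fun y => norm_nonneg _
    positivity
  have hB10 : 0 ≤ B1 := (norm_nonneg _).trans (hB1 0 ⟨le_rfl, zero_le_one⟩)
  have hb : ∀ r, 0 ≤ r → |Mfn w u 0 (k+1) r| ≤ B1 + B2 := by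
    intro r hr
    rcases le_or_gt r 1 with h | h
    · have := hB1 r ⟨hr, h⟩
      rw [norm_eq_abs] at this
      linarith
    · suffices |Mfn w u 0 (k+1) r| ≤ B2 by linarith
      have hr' : 0 < r := by linarith
      unfold Mfn
      rw [scale_integral (w (k+1)) _ 0 hr', abs_mul, abs_pow, abs_neg, abs_one, one_pow, one_mul, abs_mul,
        abs_of_pos (by positivity : 0 < (r^n)⁻¹)]
      have h1 : (r^n)⁻¹ ≤ 1 := inv_le_one_of_one_le₀ (one_le_pow₀ h.le)
      refine (mul_le_of_le_one_left (abs_nonneg _) h1).trans ?_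
      refine (abs_integral_le_integral_abs).trans ?_
      rw [hB2, ← integral_const_mul, ← integral_const_mul]
      refine integral_mono_of_nonneg (Eventually.of_forall fun y => abs_nonneg _) ((hf.norm.const_mul K).const_mul 2) (Eventually.of_forall fun y => ?_)
      simp only [hPDE, abs_mul, norm_eq_abs]
      rw [abs_of_nonneg (hw.nonneg _ _), abs_of_pos (by norm_num : (0:ℝ) < 2)]
      have := hK (‖y - 0‖^2/r^2) (by positivity)
      nlinarith [abs_nonneg (f y)]
  set S := ∑ i ∈ Finset.range (k+1), |Mfn w u 0 i 0| with hS
  refine ⟨S + (B1 + B2), fun R hR => ?_⟩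
  have hRpos : 0 < R := by linarith
  rw [taylor_chain (Mfn w u 0) (Mfn_deriv hw u hu 0) k R]
  refine (abs_add_le _ _).trans ?_
  rw [add_mul]
  refine add_le_add ?_ ?_
  · refine (Finset.abs_sum_le_sum_abs _ _).trans ?_
    rw [hS, Finset.sum_mul]
    refine Finset.sum_le_sum fun i hi => ?_
    rw [abs_mul, mul_comm]
    refine mul_le_mul_of_nonneg_left ?_ (abs_nonneg _)
    rw [abs_of_nonneg (by positivity)]
    have hi' := Finset.mem_range.1 hi
    calc (R^2/2)^i / (i.factorial : ℝ) ≤ (R^2/2)^i := div_le_self (by positivity) (by exact_mod_cast Nat.one_le_iff_ne_zero.2 (Nat.factorial_ne_zero i))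
      _ ≤ (R^2)^i := by
        refine pow_le_pow_left₀ (by positivity) ?_ _
        nlinarith
      _ = R^(2*i) := by rw [pow_mul]
      _ ≤ R^(2*(k+1)) := pow_le_pow_right₀ hR (by omega)
  · rw [← norm_eq_abs]
    refine (intervalIntegral.norm_integral_le_of_norm_le_const (C := (B1+B2) * R^(2*k+1)) fun r hr => ?_).trans ?_
    · rw [Set.uIoc_of_le hRpos.le] at hr
      have h0 : 0 ≤ r := hr.1.le
      have h2 : 0 ≤ R^2 - r^2 := by nlinarith [hr.2]
      rw [norm_eq_abs, abs_mul, mul_comm]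
      refine mul_le_mul (hb r h0) ?_ (abs_nonneg _) (by positivity)
      rw [abs_of_nonneg (by positivity), mul_div_assoc]
      calc r * (((R^2-r^2)/2)^k / (k.factorial:ℝ)) ≤ R * (R^2)^k := by
            refine mul_le_mul hr.2 ?_ (by positivity) hRpos.le
            refine (div_le_self (by positivity) (by exact_mod_cast Nat.one_le_iff_ne_zero.2 (Nat.factorial_ne_zero k))).trans ?_
            refine pow_le_pow_left₀ (by positivity) ?_ _
            nlinarith
        _ = R^(2*k+1) := by rw [← pow_mul, pow_succ]; ring
    · rw [sub_zero, abs_of_pos hRpos, mul_assoc, ← pow_succ]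
      rfl

lemma abs_growth {m : ℕ} (hm : 1 ≤ m) {w : ℕ → ℝ → ℝ} (hw : Chain w) (hn : 1 ≤ n)
    (u f : EuclideanSpace ℝ (Fin n) → ℝ) (hu : ContDiff ℝ (⊤ : ℕ∞) u)
    (hf : Integrable f)
    (hPDE : ∀ x, negLapIter m u x = 2 * f x)
    (hexp : Integrable (fun x : EuclideanSpace ℝ (Fin n) => exp (n * u x - 1 * ‖x‖^2))) :
    ∃ C, ∀ R : ℝ, 1 ≤ R → ∫ y : EuclideanSpace ℝ (Fin n), w 0 (‖y‖^2) * |u (R • y)| ≤ C * R^(2*m) := by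
  obtain ⟨C1, h1⟩ := posPart_bound hw hn u hu.continuous hexp
  obtain ⟨C2, h2⟩ := Mfn_bound hm hw u f hu hf hPDE
  have huc := hu.continuous
  refine ⟨2 * |C1| + C2, fun R hR => ?_⟩
  have e : ∀ y : EuclideanSpace ℝ (Fin n), w 0 (‖y‖^2) * |u (R • y)| =
      2 * (w 0 (‖y‖^2) * max (u (R • y)) 0) - w 0 (‖y‖^2) * u (R • y) := by
    intro y
    rcases le_total (u (R • y)) 0 with h | h
    · rw [max_eq_right h, abs_of_nonpos h]; ring
    · rw [max_eq_left h, abs_of_nonneg h]; ring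
  simp_rw [e]
  rw [integral_sub ((hw.integrable_mul 0 (by fun_prop)).const_mul 2) (hw.integrable_mul 0 (by fun_prop)), integral_const_mul]
  have h3 := h1 R hR
  have h4 := (abs_le.1 (h2 R hR)).1
  have e4 : Mfn w u 0 0 R = ∫ y, w 0 (‖y‖^2) * u (R • y) := by
    simp [Mfn, negLapIter]
  rw [e4] at h4
  have h5 : C1 * R^2 ≤ |C1| * R^(2*m) := mul_le_mul (le_abs_self _) (pow_le_pow_right₀ hR (by omega)) (by positivity) (abs_nonneg _)
  linarith
end


/-- Lagrange basis at nodes `0, …, K`. -/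
noncomputable def lag (K j : ℕ) : Polynomial ℝ :=
  Lagrange.basis (Finset.range (K+1)) (fun j : ℕ => (j:ℝ)) j

lemma lag_injOn (K : ℕ) : Set.InjOn (fun j : ℕ => (j:ℝ)) (Finset.range (K+1)) :=
  fun _ _ _ _ h => Nat.cast_injective h

lemma lag_sum (K : ℕ) (t : ℝ) : ∑ j ∈ Finset.range (K+1), (lag K j).eval t = 1 := by
  have := congrArg (Polynomial.eval t) (Lagrange.sum_basis (lag_injOn K) ⟨0, by simp⟩)
  rw [Polynomial.eval_finsetSum] at this
  simpa [lag] using this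

lemma lag_interp (K : ℕ) (P : Polynomial ℝ) (hP : P.degree < (K+1 : ℕ)) (t : ℝ) :
    P.eval t = ∑ j ∈ Finset.range (K+1), (lag K j).eval t * P.eval (j:ℝ) := by
  have := congrArg (Polynomial.eval t) (Lagrange.eq_interpolate (lag_injOn K) (f := P) (by simpa using hP))
  rw [Lagrange.interpolate_apply, Polynomial.eval_finsetSum] at this
  rw [this]
  refine Finset.sum_congr rfl fun j _ => ?_
  simp [lag, mul_comm]

lemma lag_error (K : ℕ) (t : ℝ) : ∃ C, 0 ≤ C ∧ ∀ (g : ℝ → ℝ) (B : ℝ), ContDiff ℝ (⊤ : ℕ∞) g →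
    (∀ s, |iteratedDeriv (K+1) g s| ≤ B) →
    |g t - ∑ j ∈ Finset.range (K+1), (lag K j).eval t * g j| ≤ C * B := by
  set T : ℝ := |t| + (K+1) with hT
  have hTpos : 0 < T := by positivity
  set D : ℝ := (2*T)^(K+1) / K.factorial with hD
  refine ⟨D * (1 + ∑ j ∈ Finset.range (K+1), |(lag K j).eval t|), by positivity, fun g B hg hB => ?_⟩
  have hB0 : 0 ≤ B := (abs_nonneg _).trans (hB 0)
  set s := Set.Icc (-T) T with hs
  have hud : UniqueDiffOn ℝ s := uniqueDiffOn_Icc (by linarith)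
  set P : Polynomial ℝ := ∑ k ∈ Finset.range (K+1), Polynomial.C (((k.factorial:ℝ))⁻¹ * iteratedDerivWithin k g s (-T)) * (Polynomial.X - Polynomial.C (-T))^k with hP
  have hPe : ∀ x, P.eval x = taylorWithinEval g K s (-T) x := by
    intro x
    rw [taylor_within_apply, hP, Polynomial.eval_finsetSum]
    refine Finset.sum_congr rfl fun k _ => ?_
    simp; ring
  have hPd : P.degree < (K+1 : ℕ) := by
    rw [hP]
    refine (Polynomial.degree_sum_le _ _).trans_lt ?_
    rw [Finset.sup_lt_iff (by simp [bot_lt_iff_ne_bot])]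
    intro k hk
    refine (Polynomial.degree_mul_le _ _).trans_lt ?_
    refine (add_le_add_left Polynomial.degree_C_le _).trans_lt ?_
    rw [Polynomial.degree_pow, Polynomial.degree_X_sub_C, zero_add, nsmul_one]
    exact_mod_cast Finset.mem_range.1 hk
  have herr : ∀ x ∈ s, |g x - P.eval x| ≤ D * B := by
    intro x hx
    rw [hPe]
    have := taylor_mean_remainder_bound (f := g) (a := -T) (b := T) (C := B) (x := x) (n := K) (by linarith)
      ((hg.of_le (by exact_mod_cast le_top)).contDiffOn) hx (fun y hy => by
        rw [iteratedDerivWithin_eq_iteratedDeriv hud (hg.of_le (by exact_mod_cast le_top)).contDiffAt hy]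
        exact hB y)
    refine this.trans ?_
    rw [hD, div_mul_eq_mul_div, mul_comm]
    have h1 : 0 ≤ x - -T := by linarith [hx.1]
    have h2 : x - -T ≤ 2 * T := by linarith [hx.2]
    gcongr
  have ht : t ∈ s := ⟨by linarith [neg_abs_le t], by linarith [le_abs_self t]⟩
  have hj : ∀ j ∈ Finset.range (K+1), (j:ℝ) ∈ s := by
    intro j hj
    have : (j:ℝ) < K + 1 := by exact_mod_cast Finset.mem_range.1 hj
    have h0 : (0:ℝ) ≤ j := by positivity
    exact ⟨by linarith, by linarith [abs_nonneg t]⟩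
  have e : g t - ∑ j ∈ Finset.range (K+1), (lag K j).eval t * g j =
      (g t - P.eval t) - ∑ j ∈ Finset.range (K+1), (lag K j).eval t * (g j - P.eval (j:ℝ)) := by
    simp_rw [mul_sub, Finset.sum_sub_distrib]
    rw [← lag_interp K P hPd t]; ring
  rw [e]
  refine (abs_sub _ _).trans ?_
  rw [mul_add, add_mul, mul_one]
  refine add_le_add (herr t ht) ?_
  refine (Finset.abs_sum_le_sum_abs _ _).trans ?_
  rw [Finset.mul_sum, Finset.sum_mul]
  refine Finset.sum_le_sum fun j hjm => ?_
  rw [abs_mul]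
  have := herr _ (hj j hjm)
  nlinarith [abs_nonneg ((lag K j).eval t)]

section
variable {n : ℕ}

lemma line_deriv_bound {W : EuclideanSpace ℝ (Fin n) → ℝ} (hW : ContDiff ℝ (⊤ : ℕ∞) W)
    (hc : HasCompactSupport W) (N : ℕ) : ∃ B, 0 ≤ B ∧ ∀ (z v : EuclideanSpace ℝ (Fin n)) (s : ℝ),
      |iteratedDeriv N (fun s : ℝ => W (z + s • v)) s| ≤ B * ‖v‖^N := by
  have hN : ((N:ℕ) : WithTop ℕ∞) ≤ ((⊤ : ℕ∞) : WithTop ℕ∞) := by exact_mod_cast le_top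
  obtain ⟨B, hB⟩ := (hW.continuous_iteratedFDeriv hN).bounded_above_of_compact_support (hc.iteratedFDeriv N)
  refine ⟨B, (norm_nonneg _).trans (hB 0), fun z v s => ?_⟩
  rw [← norm_eq_abs, ← norm_iteratedFDeriv_eq_norm_iteratedDeriv]
  have h1 : ContDiff ℝ (⊤ : ℕ∞) (fun y => W (z + y)) := hW.comp (by fun_prop)
  have e : (fun s : ℝ => W (z + s • v)) = (fun y => W (z + y)) ∘ (ContinuousLinearMap.toSpanSingleton ℝ v) := by
    ext s; simp
  rw [e, ContinuousLinearMap.iteratedFDeriv_comp_right _ h1 s hN, iteratedFDeriv_comp_add_left]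
  refine (ContinuousMultilinearMap.norm_compContinuousLinearMap_le _ _).trans ?_
  rw [Finset.prod_const, ContinuousLinearMap.norm_toSpanSingleton, Finset.card_univ, Fintype.card_fin]
  exact mul_le_mul_of_nonneg_right (hB _) (by positivity)

lemma Mfn_shift {w : ℕ → ℝ → ℝ} (u : EuclideanSpace ℝ (Fin n) → ℝ) (z : EuclideanSpace ℝ (Fin n)) {R : ℝ} (hR : 0 < R) :
    Mfn w u z 0 R = ∫ y, w 0 (‖y - R⁻¹ • z‖^2) * u (R • y) := by
  rw [← integral_add_right_eq_self _ (R⁻¹ • z)]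
  simp [Mfn, negLapIter, smul_smul, hR.ne', add_comm]

lemma line_limit {m : ℕ} {w : ℕ → ℝ → ℝ} (hw : Chain w) (u : EuclideanSpace ℝ (Fin n) → ℝ) (hu : Continuous u)
    {C : ℝ} (hC : ∀ R : ℝ, 1 ≤ R → ∫ y : EuclideanSpace ℝ (Fin n), w 0 (‖y‖^2) * |u (R • y)| ≤ C * R^(2*m))
    (x : EuclideanSpace ℝ (Fin n)) (t : ℝ) :
    Tendsto (fun R : ℝ => Mfn w u (t • x) 0 R -
      ∑ j ∈ Finset.range (2*m+1), (lag (2*m) j).eval t * Mfn w u ((j:ℝ) • x) 0 R) atTop (𝓝 0) := by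
  obtain ⟨B, hB0, hB⟩ := line_deriv_bound (hw.contDiff_norm (n := n) 0) (hw.compactSupport 0) (2*m+1)
  obtain ⟨D, hD0, hD⟩ := lag_error (2*m) t
  set T : ℝ := |t| + (2*m+1) with hT
  have hC0 : 0 ≤ C := by
    have := hC 1 le_rfl
    have h2 : 0 ≤ ∫ y : EuclideanSpace ℝ (Fin n), w 0 (‖y‖^2) * |u ((1:ℝ) • y)| :=
      integral_nonneg fun y => mul_nonneg (hw.nonneg _ _) (abs_nonneg _)
    simp at this h2
    linarith
  set K : ℝ := D * (B * ‖x‖^(2*m+1)) with hK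
  have hK0 : 0 ≤ K := by positivity
  have hbound : ∀ R : ℝ, 1 ≤ R → T * ‖x‖ ≤ R → |Mfn w u (t • x) 0 R -
      ∑ j ∈ Finset.range (2*m+1), (lag (2*m) j).eval t * Mfn w u ((j:ℝ) • x) 0 R| ≤
      (K * (4^n * (C * 4^(2*m)))) * R⁻¹ := by
    intro R hR hRT
    have hRpos : 0 < R := by linarith
    have hintg : ∀ z : EuclideanSpace ℝ (Fin n), Integrable (fun y : EuclideanSpace ℝ (Fin n) => w 0 (‖y - z‖^2) * u (R • y)) := by
      intro z
      have := (hw.integrable_mul (n := n) 0 (g := fun y => u (R • (y + z))) (by fun_prop)).comp_sub_right z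
      simpa using this
    have hintg2 : Integrable (fun y : EuclideanSpace ℝ (Fin n) => w 0 (‖y - 0‖^2/4^2) * |u (R • y)|) := by
      have := (hw.integrable_mul (n := n) 0 (g := fun y => |u (R • ((4:ℝ) • y))|) (by fun_prop)).comp_smul (R := (4:ℝ)⁻¹) (by norm_num)
      refine this.congr (Eventually.of_forall fun y => ?_)
      simp [norm_smul]
      left; congr 1; ring
    simp_rw [Mfn_shift u _ hRpos]
    simp_rw [← integral_const_mul]
    rw [← integral_finsetSum _ (fun j _ => (hintg _).const_mul _), ← integral_sub (hintg _)
      (integrable_finsetSum _ (fun j _ => (hintg _).const_mul _))]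
    have hpt : ∀ y : EuclideanSpace ℝ (Fin n), |w 0 (‖y - R⁻¹ • t • x‖^2) * u (R • y) -
        ∑ j ∈ Finset.range (2*m+1), (lag (2*m) j).eval t * (w 0 (‖y - R⁻¹ • (j:ℝ) • x‖^2) * u (R • y))| ≤
        (K * (R⁻¹)^(2*m+1)) * (w 0 (‖y - 0‖^2/4^2) * |u (R • y)|) := by
      intro y
      set g : ℝ → ℝ := fun s => w 0 (‖y + s • (-(R⁻¹ • x))‖^2) with hg
      have hge : ∀ s : ℝ, w 0 (‖y - R⁻¹ • s • x‖^2) = g s := by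
        intro s
        simp only [hg]
        congr 3
        rw [smul_neg, smul_comm, sub_eq_add_neg]
      have hgs : ContDiff ℝ (⊤ : ℕ∞) g := (hw.contDiff_norm (n := n) 0).comp (by fun_prop)
      have hgb := hD g (B * ‖-(R⁻¹ • x)‖^(2*m+1)) hgs (hB y _)
      rw [norm_neg, norm_smul, norm_eq_abs, abs_of_pos (inv_pos.2 hRpos), mul_pow] at hgb
      have e : w 0 (‖y - R⁻¹ • t • x‖^2) * u (R • y) -
        ∑ j ∈ Finset.range (2*m+1), (lag (2*m) j).eval t * (w 0 (‖y - R⁻¹ • (j:ℝ) • x‖^2) * u (R • y)) =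
        (g t - ∑ j ∈ Finset.range (2*m+1), (lag (2*m) j).eval t * g j) * u (R • y) := by
        simp_rw [hge, sub_mul, Finset.sum_mul, mul_assoc]
      rw [e, abs_mul, ← mul_assoc]
      refine mul_le_mul_of_nonneg_right ?_ (abs_nonneg _)
      rcases le_or_gt ‖y‖ 2 with hy | hy
      · rw [hw.one _ (by rw [sub_zero]; nlinarith [norm_nonneg y]), mul_one]
        refine hgb.trans (le_of_eq ?_)
        rw [hK]; ring
      · have hz : ∀ s : ℝ, |s| ≤ T → g s = 0 := by
          intro s hs
          rw [← hge]
          refine hw.norm_zero 0 ?_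
          have h1 : ‖R⁻¹ • s • x‖ ≤ 1 := by
            rw [norm_smul, norm_smul, norm_eq_abs, abs_of_pos (inv_pos.2 hRpos), norm_eq_abs, inv_mul_le_iff₀ hRpos, mul_one]
            exact (mul_le_mul_of_nonneg_right hs (norm_nonneg _)).trans hRT
          have := norm_sub_norm_le y (R⁻¹ • s • x)
          linarith
        rw [hz t (by rw [hT]; linarith [(by positivity : (0:ℝ) ≤ 2*m+1)]), Finset.sum_eq_zero, sub_zero, abs_zero]
        · have := hw.nonneg 0 (‖y - 0‖^2/4^2)
          positivity
        · intro j hj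
          rw [hz, mul_zero]
          have : (j:ℝ) < 2*m+1 := by exact_mod_cast Finset.mem_range.1 hj
          rw [abs_of_nonneg (by positivity)]
          linarith [abs_nonneg t]
    refine (abs_integral_le_integral_abs).trans ?_
    refine (integral_mono_of_nonneg (Eventually.of_forall fun y => abs_nonneg _) (hintg2.const_mul _) (Eventually.of_forall hpt)).trans ?_
    rw [integral_const_mul]
    have hsc := scale_integral (w 0) (fun y => |u (R • y)|) 0 (r := 4) (by norm_num)
    have hA := hC (4 * R) (by linarith)
    have e2 : ∫ y : EuclideanSpace ℝ (Fin n), w 0 (‖y - 0‖^2/4^2) * |u (R • y)| = 4^n * ∫ y : EuclideanSpace ℝ (Fin n), w 0 (‖y‖^2) * |u ((4 * R) • y)| := by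
      rw [eq_comm, ← eq_inv_mul_iff_mul_eq₀ (by positivity)]
      rw [← hsc]
      simp [smul_smul, mul_comm]
    rw [e2]
    calc _ ≤ K * R⁻¹^(2*m+1) * (4^n * (C * (4*R)^(2*m))) := by gcongr
      _ = (K * (4^n * (C * 4^(2*m)))) * R⁻¹ * (R⁻¹ * R)^(2*m) := by rw [mul_pow, mul_pow]; ring
      _ = _ := by rw [inv_mul_cancel₀ hRpos.ne', one_pow, mul_one]
  have hlim : Tendsto (fun R : ℝ => (K * (4^n * (C * 4^(2*m)))) * R⁻¹) atTop (𝓝 0) := by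
    simpa using tendsto_inv_atTop_zero.const_mul (K * (4^n * (C * 4^(2*m))))
  refine squeeze_zero_norm' ?_ hlim
  filter_upwards [eventually_ge_atTop 1, eventually_ge_atTop (T * ‖x‖)] with R h1 h2
  exact hbound R h1 h2

lemma H_line {m : ℕ} (hm : 1 ≤ m) (hn : n = 2 * m) 
    (u f : EuclideanSpace ℝ (Fin n) → ℝ) (hu : ContDiff ℝ (⊤ : ℕ∞) u) (hfc : Continuous f)
    (hf : Integrable f)
    (hPDE : ∀ x, negLapIter m u x = 2 * f x)
    (hexp : Integrable (fun x : EuclideanSpace ℝ (Fin n) => exp (n * u x - 1 * ‖x‖^2)))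
    {H : EuclideanSpace ℝ (Fin n) → ℝ} (hH : H = fun x => u x - u 0 - Npot f x)
    (x : EuclideanSpace ℝ (Fin n)) (t : ℝ) :
    H (t • x) = ∑ j ∈ Finset.range (2*m+1), (lag (2*m) j).eval t * H ((j:ℝ) • x) := by
  have hw := chain_chainFn
  obtain ⟨a, ha⟩ := exists_weights m
  obtain ⟨C, hC⟩ := abs_growth hm hw (by omega) u f hu hf hPDE hexp
  have hlim := fun x => limit_H hm hn hw ha u f hu hfc hf hPDE x
  have h0 := fun x t => line_limit hw u hu.continuous hC x t
  set I := ∫ y : EuclideanSpace ℝ (Fin n), chainFn 0 (‖y‖^2) with hI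
  have hIpos : 0 < I := by
    refine (hw.cont_norm 0).integral_pos_of_hasCompactSupport_nonneg_nonzero (x := 0) (hw.compactSupport 0)
      (fun y => hw.nonneg _ _) ?_
    rw [hw.one _ (by simp)]
    norm_num
  have l1 : Tendsto (fun R : ℝ => ∑ k ∈ Finset.range m, a k * (Mfn chainFn u (t • x) 0 ((k+1) * R) -
      ∑ j ∈ Finset.range (2*m+1), (lag (2*m) j).eval t * Mfn chainFn u ((j:ℝ) • x) 0 ((k+1) * R))) atTop (𝓝 0) := by
    have : ∀ k ∈ Finset.range m, Tendsto (fun R : ℝ => a k * (Mfn chainFn u (t • x) 0 ((k+1) * R) -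
      ∑ j ∈ Finset.range (2*m+1), (lag (2*m) j).eval t * Mfn chainFn u ((j:ℝ) • x) 0 ((k+1) * R))) atTop (𝓝 0) := by
      intro k _
      have h1 : Tendsto (fun R : ℝ => ((k:ℝ)+1) * R) atTop atTop := tendsto_id.const_mul_atTop (by positivity)
      simpa using ((h0 x t).comp h1).const_mul (a k)
    simpa using tendsto_finsetSum _ this
  have l2 := (hlim (t • x)).sub (tendsto_finsetSum (Finset.range (2*m+1)) fun j _ => (hlim ((j:ℝ) • x)).const_mul ((lag (2*m) j).eval t))
  have l3 := tendsto_nhds_unique (l2.congr fun R => ?_) l1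
  · rw [hH]
    have : I * ((u (t • x) - u 0 - Npot f (t • x)) - ∑ j ∈ Finset.range (2*m+1), (lag (2*m) j).eval t * (u ((j:ℝ) • x) - u 0 - Npot f ((j:ℝ) • x))) = 0 := by
      rw [← l3, mul_sub, Finset.mul_sum]
      congr 1
      refine Finset.sum_congr rfl fun j _ => ?_
      ring
    rcases mul_eq_zero.1 this with h | h
    · exact absurd h hIpos.ne'
    · linarith
  · simp_rw [Finset.mul_sum]
    rw [Finset.sum_comm, ← Finset.sum_sub_distrib]
    refine Finset.sum_congr rfl fun k _ => ?_
    have hs := lag_sum (2*m) t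
    simp_rw [mul_sub, Finset.sum_sub_distrib, Finset.mul_sum]
    have e : ∑ j ∈ Finset.range (2*m+1), (lag (2*m) j).eval t * (a k * Mfn chainFn u 0 0 ((k+1)*R)) = a k * Mfn chainFn u 0 0 ((k+1)*R) := by
      rw [← Finset.sum_mul, hs, one_mul]
    rw [e]
    rw [sub_sub_sub_cancel_right]
    congr 1
    refine Finset.sum_congr rfl fun j _ => ?_
    ring
end


section
variable {n : ℕ}

lemma Npot_continuous (hn : 2 ≤ n) {f : EuclideanSpace ℝ (Fin n) → ℝ} (hc : Continuous f)
    (hf : Integrable f) : Continuous (Npot f) := by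
  have : Nontrivial (EuclideanSpace ℝ (Fin n)) :=
    Module.nontrivial_of_finrank_pos (R := ℝ) (by rw [finrank_euclideanSpace_fin]; omega)
  unfold Npot
  refine continuous_const.mul ?_
  rw [continuous_iff_continuousAt]
  intro x0
  set R : ℝ := 2 * (‖x0‖ + 1) with hR
  have hRpos : 0 < R := by positivity
  have hw := chain_chainFn
  obtain ⟨K, hK⟩ := hw.bdd 0
  set χ : EuclideanSpace ℝ (Fin n) → ℝ := fun y => chainFn 0 (‖y‖^2 / (2*R)^2) with hχ
  have hχc : Continuous χ := (hw.smooth 0).continuous.comp (by fun_prop)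
  have hχs : HasCompactSupport χ := by
    refine HasCompactSupport.intro (isCompact_closedBall 0 (2*R)) fun y hy => ?_
    refine hw.zero 0 _ ?_
    rw [one_le_div (by positivity)]
    simp at hy
    gcongr
  set f1 : EuclideanSpace ℝ (Fin n) → ℝ := fun y => χ y * f y with hf1
  set f2 : EuclideanSpace ℝ (Fin n) → ℝ := fun y => (1 - χ y) * f y with hf2
  have hf1c : Continuous f1 := hχc.mul hc
  have hf2c : Continuous f2 := (continuous_const.sub hχc).mul hc
  have hf1s : HasCompactSupport f1 := hχs.mul_right
  have hf1i : Integrable f1 := hf1c.integrable_of_hasCompactSupport hf1s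
  have hf2e : ∀ y, f2 y = f y - f1 y := fun y => by simp only [hf1, hf2]; ring
  have hf2i : Integrable f2 := (hf.sub hf1i).congr (Eventually.of_forall fun y => (hf2e y).symm)
  have hsplit : ∀ x, ∫ y, log (‖y‖ / ‖x - y‖) * f y =
      (∫ y, log (‖y‖ / ‖x - y‖) * f1 y) + ∫ y, log (‖y‖ / ‖x - y‖) * f2 y := by
    intro x
    rw [← integral_add (integrable_log hn hf1c hf1i x) (integrable_log hn hf2c hf2i x)]
    congr 1; ext y
    rw [hf2e]; ring
  simp_rw [hsplit]
  refine ContinuousAt.add ?_ ?_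
  · have hconv := (HasCompactSupport.continuous_convolution_right (μ := volume) (ContinuousLinearMap.mul ℝ ℝ) hf1s (locInt_log hn) hf1c)
    have hloc : ∀ z : EuclideanSpace ℝ (Fin n), Integrable (fun y => log ‖z - y‖ * f1 y) := by
      intro z
      obtain ⟨B, hB⟩ := hf1c.bounded_above_of_compact_support hf1s
      have h1 := intOn_sub (locInt_log hn) z (2*R+1)
      have h2 : IntegrableOn (fun y => log ‖z - y‖ * f1 y) (ball 0 (2*R+1)) := by
        refine Integrable.mul_bdd (c := B) h1 hf1c.aestronglyMeasurable.restrict (Eventually.of_forall hB)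
      refine (integrableOn_iff_integrable_of_support_subset ?_).1 h2
      intro y hy
      by_contra hy'
      apply hy
      have : χ y = 0 := by
        refine hw.zero 0 _ ?_
        rw [one_le_div (by positivity)]
        simp at hy'
        have : 2 * R ≤ ‖y‖ := by linarith
        gcongr
      simp [hf1, this]
    have e : (fun x => ∫ y, log (‖y‖ / ‖x - y‖) * f1 y) = fun x =>
        (∫ y, log ‖(0 : EuclideanSpace ℝ (Fin n)) - y‖ * f1 y) - convolution (fun z => log ‖z‖) f1 (ContinuousLinearMap.mul ℝ ℝ) volume x := by
      ext x
      have e1 : convolution (fun z => log ‖z‖) f1 (ContinuousLinearMap.mul ℝ ℝ) volume x = ∫ y, log ‖x - y‖ * f1 y := by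
        rw [convolution, ← integral_sub_left_eq_self _ volume x]
        simp
      rw [e1, ← integral_sub (hloc 0) (hloc x)]
      refine integral_congr_ae ?_
      have a1 : ∀ᵐ y : EuclideanSpace ℝ (Fin n), y ≠ 0 := by simp [ae_iff]
      have a2 : ∀ᵐ y : EuclideanSpace ℝ (Fin n), y ≠ x := by simp [ae_iff]
      filter_upwards [a1, a2] with y h1 h2
      rw [log_div (norm_ne_zero_iff.2 h1) (norm_ne_zero_iff.2 (sub_ne_zero.2 h2.symm)), zero_sub, norm_neg]
      ring
    rw [e]
    exact (continuous_const.sub hconv).continuousAt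
  · refine continuousAt_of_dominated (bound := fun y => log 2 * ((1 + K) * ‖f y‖)) ?_ ?_ ((hf.norm.const_mul _).const_mul _) ?_
    · exact Eventually.of_forall fun x => (integrable_log hn hf2c hf2i x).1
    · have : ball x0 1 ∈ 𝓝 x0 := ball_mem_nhds _ one_pos
      filter_upwards [this] with x hx
      refine Eventually.of_forall fun y => ?_
      have hl2 : 0 ≤ log 2 := log_nonneg (by norm_num)
      rw [norm_mul]
      have hχ0 : 0 ≤ χ y := hw.nonneg _ _
      have hχK : χ y ≤ K := hK _ (by positivity)
      rcases le_or_gt ‖y‖ R with hy | hy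
      · have : χ y = 1 := by
          refine hw.one _ ?_
          rw [div_le_iff₀ (by positivity)]
          nlinarith [norm_nonneg y]
        simp only [hf2, this, sub_self, zero_mul, norm_zero, mul_zero]
        have : 0 ≤ K := hχ0.trans hχK
        positivity
      · refine mul_le_mul (log_ratio_bound ?_) ?_ (norm_nonneg _) hl2
        · have := norm_sub_norm_le x x0
          rw [mem_ball, dist_eq_norm] at hx
          linarith
        · simp only [hf2]
          rw [norm_mul]
          refine mul_le_mul_of_nonneg_right ?_ (norm_nonneg _)
          rw [norm_eq_abs, abs_le]; constructor <;> linarith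
    · have a1 : ∀ᵐ y : EuclideanSpace ℝ (Fin n), y ≠ 0 := by simp [ae_iff]
      have a2 : ∀ᵐ y : EuclideanSpace ℝ (Fin n), y ≠ x0 := by simp [ae_iff]
      filter_upwards [a1, a2] with y h1 h2
      have h3 : ‖x0 - y‖ ≠ 0 := norm_ne_zero_iff.2 (sub_ne_zero.2 h2.symm)
      have h4 : ‖y‖ / ‖x0 - y‖ ≠ 0 := div_ne_zero (norm_ne_zero_iff.2 h1) h3
      refine ContinuousAt.mul ?_ continuousAt_const
      refine ContinuousAt.log ?_ h4
      exact continuousAt_const.div (by fun_prop) h3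

lemma lag_natDegree (K j : ℕ) (hj : j ∈ Finset.range (K+1)) : (lag K j).natDegree < K + 1 := by
  unfold lag
  rw [Lagrange.natDegree_basis (lag_injOn K) hj]
  simp

/-- Expansion on lines gives continuous coefficients. -/
lemma line_coeffs {K : ℕ} {H : EuclideanSpace ℝ (Fin n) → ℝ} (hHc : Continuous H)
    (hl : ∀ x (t:ℝ), H (t • x) = ∑ j ∈ Finset.range (K+1), (lag K j).eval t * H ((j:ℝ) • x)) :
    ∃ a : ℕ → EuclideanSpace ℝ (Fin n) → ℝ, (∀ i, Continuous (a i)) ∧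
      ∀ x (t:ℝ), H (t • x) = ∑ i ∈ Finset.range (K+1), a i x * t^i := by
  refine ⟨fun i x => ∑ j ∈ Finset.range (K+1), (lag K j).coeff i * H ((j:ℝ) • x), ?_, ?_⟩
  · intro i
    fun_prop
  · intro x t
    rw [hl]
    simp_rw [Finset.sum_mul]
    rw [Finset.sum_comm]
    refine Finset.sum_congr rfl fun j hj => ?_
    rw [Polynomial.eval_eq_sum_range' (lag_natDegree K j hj), Finset.sum_mul]
    refine Finset.sum_congr rfl fun i _ => ?_
    ring

lemma poly_asymp {d : ℕ} (hd : 1 ≤ d) (a : ℕ → EuclideanSpace ℝ (Fin n) → ℝ) (ha : ∀ i, Continuous (a i))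
    {θ : EuclideanSpace ℝ (Fin n)} (hθ : a d θ < 0) :
    ∃ ρ > 0, ∃ c > 0, ∃ T ≥ 1, ∀ x ∈ ball θ ρ, ∀ t ≥ T,
      ∑ i ∈ Finset.range (d+1), a i x * t^i ≤ - c * t^d := by
  set c : ℝ := -(a d θ) / 4 with hcdef
  have hc : 0 < c := by rw [hcdef]; linarith
  have h1 : ∀ᶠ x in 𝓝 θ, a d x < -(2*c) := (ha d).continuousAt.eventually_lt continuousAt_const (by rw [hcdef]; linarith)
  obtain ⟨ρ1, hρ1, hb1⟩ := Metric.eventually_nhds_iff_ball.1 h1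
  set S : EuclideanSpace ℝ (Fin n) → ℝ := fun x => ∑ i ∈ Finset.range d, |a i x| with hS
  have hSc : Continuous S := by
    refine continuous_finsetSum _ fun i _ => (ha i).abs
  have h2 : ∀ᶠ x in 𝓝 θ, S x < S θ + 1 := hSc.continuousAt.eventually_lt continuousAt_const (by linarith)
  obtain ⟨ρ2, hρ2, hb2⟩ := Metric.eventually_nhds_iff_ball.1 h2
  refine ⟨min ρ1 ρ2, lt_min hρ1 hρ2, c, hc, max 1 ((S θ + 1)/c), le_max_left _ _, fun x hx t ht => ?_⟩
  have ht1 : 1 ≤ t := (le_max_left _ _).trans ht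
  have ht2 : S θ + 1 ≤ c * t := by
    have := (le_max_right _ _).trans ht
    rw [div_le_iff₀ hc] at this
    linarith
  have e1 := hb1 x (ball_subset_ball (min_le_left _ _) hx)
  have e2 := hb2 x (ball_subset_ball (min_le_right _ _) hx)
  rw [Finset.sum_range_succ]
  have e3 : ∑ i ∈ Finset.range d, a i x * t^i ≤ S x * t^(d-1) := by
    rw [hS, Finset.sum_mul]
    refine Finset.sum_le_sum fun i hi => ?_
    have hi' := Finset.mem_range.1 hi
    refine mul_le_mul (le_abs_self _) (pow_le_pow_right₀ ht1 (by omega)) (by positivity) (abs_nonneg _)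
  have e4 : S x * t^(d-1) ≤ c * t^d := by
    obtain ⟨k, rfl⟩ : ∃ k, d = k+1 := ⟨d-1, by omega⟩
    rw [Nat.add_sub_cancel, pow_succ', ← mul_assoc]
    refine mul_le_mul_of_nonneg_right (by linarith) (by positivity)
  have e5 : a d x * t^d ≤ -(2*c) * t^d := mul_le_mul_of_nonneg_right e1.le (by positivity)
  linarith
end


section
variable {n : ℕ}

lemma k_integrable (hn : 2 ≤ n) {f : EuclideanSpace ℝ (Fin n) → ℝ} (hc : Continuous f)
    (hf : Integrable f) (x : EuclideanSpace ℝ (Fin n)) :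
    Integrable (fun y => max 1 (‖x - y‖⁻¹) * f y) := by
  have hm : AEStronglyMeasurable (fun y => max 1 (‖x - y‖⁻¹)) (volume : Measure (EuclideanSpace ℝ (Fin n))) := by
    apply Measurable.aestronglyMeasurable; fun_prop
  rw [← integrableOn_univ, ← Set.union_compl_self (ball (0 : EuclideanSpace ℝ (Fin n)) (‖x‖+1))]
  refine IntegrableOn.union ?_ ?_
  · obtain ⟨B, hB⟩ := (isCompact_closedBall (0 : EuclideanSpace ℝ (Fin n)) (‖x‖+1)).exists_bound_of_continuousOn hc.continuousOn
    have h2 := intOn_sub (locInt_inv hn) x (‖x‖+1)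
    have h1 : IntegrableOn (fun y : EuclideanSpace ℝ (Fin n) => (1:ℝ)) (ball 0 (‖x‖+1)) :=
      integrableOn_const (by simp [measure_ball_lt_top.ne])
    refine Integrable.mono' ((h1.add h2).mul_const B) (hm.mul hc.aestronglyMeasurable).restrict ?_
    filter_upwards [ae_restrict_mem measurableSet_ball] with y hy
    rw [norm_mul]
    have h0 : 0 ≤ ‖x - y‖⁻¹ := by positivity
    refine mul_le_mul ?_ (hB y (ball_subset_closedBall hy)) (norm_nonneg _) (by simp only [Pi.add_apply]; positivity)
    simp only [Pi.add_apply]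
    rw [norm_eq_abs, abs_of_nonneg (by positivity)]
    exact max_le (by linarith) (by linarith)
  · refine Integrable.mono' (hf.norm.integrableOn) (hm.mul hc.aestronglyMeasurable).restrict ?_
    filter_upwards [ae_restrict_mem measurableSet_ball.compl] with y hy
    have hy' : ‖x‖ + 1 ≤ ‖y‖ := by simpa using hy
    have h1 := norm_sub_norm_le y x
    rw [norm_sub_rev] at h1
    have h2 : ‖x - y‖⁻¹ ≤ 1 := inv_le_one_of_one_le₀ (by linarith)
    rw [norm_mul, max_eq_left h2]; simp

lemma k_ball_bound (hn : 2 ≤ n) (θ : EuclideanSpace ℝ (Fin n)) (ρ : ℝ) :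
    ∃ C : ℝ≥0∞, C < ⊤ ∧ ∀ z : EuclideanSpace ℝ (Fin n),
      ∫⁻ x in ball θ ρ, ENNReal.ofReal (max 1 (‖x - z‖⁻¹)) ≤ C := by
  set g : EuclideanSpace ℝ (Fin n) → ℝ≥0∞ := (ball 0 1).indicator (fun v => ENNReal.ofReal (‖v‖⁻¹)) with hg
  have hgm : Measurable g := Measurable.indicator (by fun_prop) measurableSet_ball
  have hgf : ∫⁻ v, g v < ⊤ := by
    rw [hg, lintegral_indicator measurableSet_ball]
    have : IntegrableOn (fun z : EuclideanSpace ℝ (Fin n) => ‖z‖⁻¹) (ball 0 1) :=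
      ((locInt_inv hn).integrableOn_isCompact (isCompact_closedBall 0 1)).mono_set ball_subset_closedBall
    exact this.lintegral_lt_top
  refine ⟨volume (ball θ ρ) + ∫⁻ v, g v, ENNReal.add_lt_top.2 ⟨measure_ball_lt_top, hgf⟩, fun z => ?_⟩
  have hpt : ∀ x, ENNReal.ofReal (max 1 (‖x - z‖⁻¹)) ≤ 1 + g (x - z) := by
    intro x
    by_cases h : x - z ∈ ball (0 : EuclideanSpace ℝ (Fin n)) 1
    · rw [hg, Set.indicator_of_mem h, ← ENNReal.ofReal_one, ← ENNReal.ofReal_add zero_le_one (by positivity)]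
      refine ENNReal.ofReal_le_ofReal ?_
      have h0 : 0 ≤ ‖x - z‖⁻¹ := by positivity
      exact max_le (by linarith) (by linarith)
    · have h' : 1 ≤ ‖x - z‖ := by simpa using h
      rw [max_eq_left (inv_le_one_of_one_le₀ h'), ENNReal.ofReal_one]
      exact le_self_add
  calc _ ≤ ∫⁻ x in ball θ ρ, (1 + g (x - z)) := lintegral_mono hpt
    _ = volume (ball θ ρ) + ∫⁻ x in ball θ ρ, g (x - z) := by
      rw [lintegral_add_left measurable_const]; simp
    _ ≤ volume (ball θ ρ) + ∫⁻ x, g (x - z) := by gcongr; exact Measure.restrict_le_self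
    _ = _ := by rw [lintegral_sub_right_eq_self]

lemma exp_jensen {α : Type*} [MeasurableSpace α] {μ : Measure α} {g h : α → ℝ}
    (hh : Integrable h μ) (hh0 : ∀ᵐ y ∂μ, 0 ≤ h y) (hσ : ∫ y, h y ∂μ ≤ 1) (hg0 : ∀ y, 0 ≤ g y)
    (hgh : Integrable (fun y => g y * h y) μ) (hegh : Integrable (fun y => exp (g y) * h y) μ) :
    exp (∫ y, g y * h y ∂μ) ≤ 1 + ∫ y, exp (g y) * h y ∂μ := by
  set G := ∫ y, g y * h y ∂μ with hG
  set σ := ∫ y, h y ∂μ with hσd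
  have hG0 : 0 ≤ G := integral_nonneg_of_ae (by filter_upwards [hh0] with y hy using mul_nonneg (hg0 y) hy)
  have hσ0 : 0 ≤ σ := integral_nonneg_of_ae hh0
  have h1 : exp G * ((1 - G) * σ + G) ≤ ∫ y, exp (g y) * h y ∂μ := by
    have e : exp G * ((1 - G) * σ + G) = ∫ y, exp G * ((1 - G) * h y + g y * h y) ∂μ := by
      rw [integral_const_mul, integral_add (hh.const_mul _) hgh, integral_const_mul]
    rw [e]
    refine integral_mono_ae (((hh.const_mul _).add hgh).const_mul _) hegh ?_
    filter_upwards [hh0] with y hy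
    have : exp G * (1 - G + g y) ≤ exp (g y) := by
      have h2 := add_one_le_exp (g y - G)
      have h3 : exp (g y) = exp G * exp (g y - G) := by rw [← exp_add]; congr 1; ring
      rw [h3]
      exact mul_le_mul_of_nonneg_left (by linarith) (exp_pos _).le
    calc exp G * ((1 - G) * h y + g y * h y) = exp G * (1 - G + g y) * h y := by ring
      _ ≤ _ := mul_le_mul_of_nonneg_right this hy
  have h2 : exp G * (1 - G) ≤ 1 := by
    have := add_one_le_exp (-G)
    have h3 : exp G * exp (-G) = 1 := by rw [← exp_add]; simp
    nlinarith [exp_pos G]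
  nlinarith [exp_pos G]

lemma exists_R0 {f : EuclideanSpace ℝ (Fin n) → ℝ} (hf : Integrable f)
    (hpos : ∃ R1 : ℝ, ∀ y, R1 ≤ ‖y‖ → 0 ≤ f y) {c : ℝ} (hc : 0 < c) :
    ∃ R0 : ℝ, 1 ≤ R0 ∧ (∀ y, R0 ≤ ‖y‖ → 0 ≤ f y) ∧ ∫ y in (ball 0 R0)ᶜ, f y ≤ c := by
  obtain ⟨R1, hR1⟩ := hpos
  have := tendsto_setIntegral_of_antitone (μ := volume) (f := f) (s := fun k : ℕ => (ball (0 : EuclideanSpace ℝ (Fin n)) (k:ℝ))ᶜ)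
    (fun k => measurableSet_ball.compl) (fun i j hij => Set.compl_subset_compl.2 (ball_subset_ball (by exact_mod_cast hij)))
    ⟨0, hf.integrableOn⟩
  have he : ⋂ k : ℕ, (ball (0 : EuclideanSpace ℝ (Fin n)) (k:ℝ))ᶜ = ∅ := by
    rw [← Set.compl_iUnion, iUnion_ball_nat, Set.compl_univ]
  rw [he, setIntegral_empty] at this
  have h1 := this.eventually (gt_mem_nhds hc)
  obtain ⟨k, hk1, hk2⟩ := (h1.and (eventually_ge_atTop (⌈max R1 1⌉₊))).exists
  have hk3 : max R1 1 ≤ (k:ℝ) := (Nat.le_ceil _).trans (by exact_mod_cast hk2)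
  exact ⟨k, (le_max_right _ _).trans hk3, fun y hy => hR1 y ((le_max_left _ _).trans (hk3.trans hy)), hk1.le⟩

lemma N_bounds (hn : 2 ≤ n) {f : EuclideanSpace ℝ (Fin n) → ℝ} (hc : Continuous f)
    (hf : Integrable f) {R0 : ℝ} (hR0 : 1 ≤ R0) (hpos : ∀ y, R0 ≤ ‖y‖ → 0 ≤ f y)
    (htail : ∫ y in (ball 0 R0)ᶜ, f y ≤ cconst n) :
    ∃ A : ℝ, 0 ≤ A ∧ ∀ x : EuclideanSpace ℝ (Fin n), 2 * R0 ≤ ‖x‖ →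
      -(A + A * log (2 * ‖x‖)) ≤ Npot f x ∧
      exp (Npot f x) ≤ exp (A + A * log (2 * ‖x‖)) *
        (1 + (1 / cconst n) * ∫ y in (ball 0 R0)ᶜ, max 1 (‖x - y‖⁻¹) * f y) := by
  have : Nontrivial (EuclideanSpace ℝ (Fin n)) :=
    Module.nontrivial_of_finrank_pos (R := ℝ) (by rw [finrank_euclideanSpace_fin]; omega)
  have hcp := cconst_pos n
  set F := ∫ y, |f y| with hF
  have hF0 : 0 ≤ F := integral_nonneg fun y => abs_nonneg _
  have hA1i : IntegrableOn (fun y => |log ‖y‖| * |f y|) (ball 0 R0) := by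
    have h1 : IntegrableOn (fun y : EuclideanSpace ℝ (Fin n) => log ‖y‖) (ball 0 R0) :=
      ((locInt_log hn).integrableOn_isCompact (isCompact_closedBall 0 R0)).mono_set ball_subset_closedBall
    obtain ⟨B, hB⟩ := (isCompact_closedBall (0 : EuclideanSpace ℝ (Fin n)) R0).exists_bound_of_continuousOn hc.continuousOn
    refine Integrable.mul_bdd (c := B) h1.norm hc.abs.aestronglyMeasurable.restrict ?_
    filter_upwards [ae_restrict_mem measurableSet_ball] with y hy
    rw [norm_eq_abs, abs_abs]
    exact hB y (ball_subset_closedBall hy)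
  set A1 := ∫ y in ball 0 R0, |log ‖y‖| * |f y| with hA1
  have hA10 : 0 ≤ A1 := integral_nonneg fun y => by positivity
  set A : ℝ := (1 / cconst n) * (A1 + 2 * F) with hA
  have hA0 : 0 ≤ A := by positivity
  refine ⟨A, hA0, fun x hx => ?_⟩
  have hx2 : 2 ≤ ‖x‖ := by linarith
  set L := log (2 * ‖x‖) with hL
  have hL0 : 0 ≤ L := log_nonneg (by linarith)
  have hsplit : ∫ y, log (‖y‖ / ‖x - y‖) * f y = (∫ y in ball 0 R0, log (‖y‖ / ‖x - y‖) * f y) +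
      ∫ y in (ball 0 R0)ᶜ, log (‖y‖ / ‖x - y‖) * f y :=
    (integral_add_compl measurableSet_ball (integrable_log hn hc hf x)).symm
  have hball : |∫ y in ball 0 R0, log (‖y‖ / ‖x - y‖) * f y| ≤ A1 + L * F := by
    have i2 : IntegrableOn (fun y => L * |f y|) (ball 0 R0) := (hf.abs.const_mul L).integrableOn
    calc _ ≤ ∫ y in ball 0 R0, |log (‖y‖ / ‖x - y‖) * f y| := abs_integral_le_integral_abs
      _ ≤ ∫ y in ball 0 R0, (|log ‖y‖| * |f y| + L * |f y|) := by
        refine setIntegral_mono_on (integrable_log hn hc hf x).abs.integrableOn (hA1i.add i2) measurableSet_ball fun y hy => ?_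
        rw [abs_mul, ← add_mul]
        refine mul_le_mul_of_nonneg_right ?_ (abs_nonneg _)
        have hy' : ‖y‖ < R0 := by simpa using hy
        have h1 := norm_sub_norm_le x y
        have h2 := norm_sub_le x y
        have h3 : 1 ≤ ‖x - y‖ := by linarith
        rcases eq_or_ne ‖y‖ 0 with h0 | h0
        · rw [h0]; simp [hL0]
        · rw [log_div h0 (by linarith)]
          refine (abs_sub _ _).trans ?_
          rw [abs_of_nonneg (log_nonneg h3)]
          have : log ‖x - y‖ ≤ L := log_le_log (by linarith) (by linarith)
          linarith
      _ = A1 + ∫ y in ball 0 R0, L * |f y| := integral_add hA1i i2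
      _ ≤ A1 + L * F := by
        rw [integral_const_mul]
        gcongr
        exact setIntegral_le_integral hf.abs (Eventually.of_forall fun y => abs_nonneg _)
  have hms : MeasurableSet (ball (0 : EuclideanSpace ℝ (Fin n)) R0)ᶜ := measurableSet_ball.compl
  have htF : ∫ y in (ball 0 R0)ᶜ, f y ≤ F := by
    refine (setIntegral_mono_on hf.integrableOn hf.abs.integrableOn hms fun y _ => le_abs_self _).trans ?_
    exact setIntegral_le_integral hf.abs (Eventually.of_forall fun y => abs_nonneg _)
  have hsmem : ∀ y ∈ (ball (0 : EuclideanSpace ℝ (Fin n)) R0)ᶜ, R0 ≤ ‖y‖ := by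
    intro y hy; simpa using hy
  have htl : -(L * F) ≤ ∫ y in (ball 0 R0)ᶜ, log (‖y‖ / ‖x - y‖) * f y := by
    have h1 : ∫ y in (ball 0 R0)ᶜ, (-L) * f y ≤ ∫ y in (ball 0 R0)ᶜ, log (‖y‖ / ‖x - y‖) * f y := by
      refine setIntegral_mono_on (hf.const_mul _).integrableOn (integrable_log hn hc hf x).integrableOn hms fun y hy => ?_
      have hy' := hsmem y hy
      refine mul_le_mul_of_nonneg_right ?_ (hpos y hy')
      rcases eq_or_ne ‖x - y‖ 0 with h0 | h0
      · rw [h0]; simp [hL0]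
      · have h0' : 0 < ‖x - y‖ := lt_of_le_of_ne (norm_nonneg _) h0.symm
        rw [hL, ← log_inv]
        refine log_le_log (by positivity) ?_
        rw [le_div_iff₀ h0', inv_mul_le_iff₀ (by positivity)]
        have h2 := norm_sub_le x y
        nlinarith
    rw [integral_const_mul] at h1
    nlinarith
  set g : EuclideanSpace ℝ (Fin n) → ℝ := fun y => log (max 1 (‖x - y‖⁻¹)) with hg
  have hg0 : ∀ y, 0 ≤ g y := fun y => log_nonneg (le_max_left _ _)
  have hge : ∀ y, exp (g y) = max 1 (‖x - y‖⁻¹) := fun y => exp_log (lt_of_lt_of_le one_pos (le_max_left _ _))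
  have hki := k_integrable hn hc hf x
  have hgi : Integrable (fun y => g y * f y) := by
    refine hki.mono ?_ (Eventually.of_forall fun y => ?_)
    · refine AEStronglyMeasurable.mul ?_ hc.aestronglyMeasurable
      apply Measurable.aestronglyMeasurable
      simp only [hg]; fun_prop
    · rw [norm_mul, norm_mul]
      refine mul_le_mul_of_nonneg_right ?_ (norm_nonneg _)
      rw [norm_eq_abs, abs_of_nonneg (hg0 y), ← hge, norm_eq_abs, abs_of_pos (exp_pos _)]
      linarith [add_one_le_exp (g y)]
  have htu : ∫ y in (ball 0 R0)ᶜ, log (‖y‖ / ‖x - y‖) * f y ≤ L * F + ∫ y in (ball 0 R0)ᶜ, g y * f y := by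
    have h1 : ∫ y in (ball 0 R0)ᶜ, log (‖y‖ / ‖x - y‖) * f y ≤ ∫ y in (ball 0 R0)ᶜ, (L * f y + g y * f y) := by
      refine setIntegral_mono_on (integrable_log hn hc hf x).integrableOn ((hf.const_mul _).add hgi).integrableOn hms fun y hy => ?_
      have hy' := hsmem y hy
      rw [← add_mul]
      refine mul_le_mul_of_nonneg_right ?_ (hpos y hy')
      rcases eq_or_ne ‖x - y‖ 0 with h0 | h0
      · rw [h0, div_zero, log_zero]; exact add_nonneg hL0 (hg0 y)
      · have h0' : 0 < ‖x - y‖ := lt_of_le_of_ne (norm_nonneg _) h0.symm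
        rw [hL, hg, ← log_mul (by positivity) (by positivity)]
        refine log_le_log (div_pos (by linarith) h0') ?_
        have h2 : ‖y‖ ≤ ‖x - y‖ + ‖x‖ := by
          have := norm_sub_norm_le y x
          rw [norm_sub_rev] at this; linarith
        have h3 : ‖y‖ / ‖x - y‖ ≤ 1 + ‖x‖ * ‖x - y‖⁻¹ := by
          rw [div_le_iff₀ h0']
          have : ‖x - y‖⁻¹ * ‖x - y‖ = 1 := inv_mul_cancel₀ h0
          nlinarith
        have h4 : (1:ℝ) ≤ max 1 (‖x - y‖⁻¹) := le_max_left _ _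
        have h5 : ‖x - y‖⁻¹ ≤ max 1 (‖x - y‖⁻¹) := le_max_right _ _
        nlinarith
    rw [integral_add (hf.const_mul _).integrableOn hgi.integrableOn, integral_const_mul] at h1
    nlinarith
  have hN : Npot f x = (1 / cconst n) * ((∫ y in ball 0 R0, log (‖y‖ / ‖x - y‖) * f y) +
      ∫ y in (ball 0 R0)ᶜ, log (‖y‖ / ‖x - y‖) * f y) := by
    rw [← hsplit]; rfl
  have hinv : 0 < 1 / cconst n := by positivity
  have hle : A1 + 2 * L * F ≤ (A1 + 2 * F) + (A1 + 2 * F) * L := by nlinarith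
  have hAe : A + A * L = (1 / cconst n) * ((A1 + 2 * F) + (A1 + 2 * F) * L) := by rw [hA]; ring
  obtain ⟨hb1, hb2⟩ := abs_le.1 hball
  constructor
  · rw [hN, hAe, ← mul_neg]
    refine mul_le_mul_of_nonneg_left ?_ hinv.le
    linarith
  · have hNu : Npot f x ≤ (A + A * L) + ∫ y in (ball 0 R0)ᶜ, g y * ((1 / cconst n) * f y) := by
      have e : ∫ y in (ball 0 R0)ᶜ, g y * ((1 / cconst n) * f y) = (1 / cconst n) * ∫ y in (ball 0 R0)ᶜ, g y * f y := by
        rw [← integral_const_mul]; congr 1; ext y; ring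
      rw [e, hN, hAe, ← mul_add]
      refine mul_le_mul_of_nonneg_left ?_ hinv.le
      linarith
    have hj := exp_jensen (μ := volume.restrict (ball (0 : EuclideanSpace ℝ (Fin n)) R0)ᶜ) (g := g)
      (h := fun y => (1 / cconst n) * f y) (hf.const_mul _).integrableOn ?_ ?_ hg0 ?_ ?_
    · refine (exp_le_exp.2 hNu).trans ?_
      rw [exp_add]
      refine mul_le_mul_of_nonneg_left (hj.trans (le_of_eq ?_)) (exp_pos _).le
      rw [← integral_const_mul]
      congr 2; ext y; rw [hge]; ring
    · filter_upwards [ae_restrict_mem hms] with y hy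
      exact mul_nonneg hinv.le (hpos y (hsmem y hy))
    · rw [integral_const_mul, one_div, inv_mul_le_iff₀ hcp, mul_one]; exact htail
    · refine (hgi.const_mul (1 / cconst n)).integrableOn.congr (Eventually.of_forall fun y => ?_)
      simp only []; ring
    · refine (hki.const_mul (1 / cconst n)).integrableOn.congr (Eventually.of_forall fun y => ?_)
      simp only [hge]; ring
end


section
variable {n : ℕ}

lemma no_growth (hn : 1 ≤ n) {u : EuclideanSpace ℝ (Fin n) → ℝ}
    (hexp : ∀ δ > (0:ℝ), Integrable (fun x => exp (n * u x - δ * ‖x‖^2)))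
    {θ : EuclideanSpace ℝ (Fin n)} {ρ c B T : ℝ} (hρ : 0 < ρ) (hc : 0 < c) (hB : 0 ≤ B)
    (h : ∀ x ∈ ball θ ρ, ∀ t ≥ T, c * t^2 - B - B * t ≤ u (t • x)) : False := by
  set M := ‖θ‖ + ρ with hM
  have hMpos : 0 < M := by positivity
  have hn0 : (0:ℝ) < n := by exact_mod_cast hn
  set δ := n * c / (2 * M^2) with hδ
  have hδpos : 0 < δ := by positivity
  have hI := hexp δ hδpos
  set g := fun x : EuclideanSpace ℝ (Fin n) => exp (n * u x - δ * ‖x‖^2) with hg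
  set J := ∫ x, g x with hJ
  set V := (volume : Measure (EuclideanSpace ℝ (Fin n))).real (ball θ ρ) with hV
  have hVpos : 0 < V := by
    rw [hV, measureReal_def]
    exact ENNReal.toReal_pos (measure_ball_pos _ _ hρ).ne' measure_ball_lt_top.ne
  have hJ0 : 0 ≤ J := integral_nonneg (fun x => (exp_pos _).le)
  set t := max T (max 1 (4 * B / c)) + J / V + 1 with ht
  have hJV : 0 ≤ J / V := by positivity
  have h1 : T ≤ t := by have := le_max_left T (max 1 (4 * B / c)); linarith
  have h2 : 1 ≤ t := by
    have := le_max_right T (max 1 (4 * B / c)); have := le_max_left 1 (4 * B / c); linarith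
  have h3 : 4 * B / c ≤ t := by
    have := le_max_right T (max 1 (4 * B / c)); have := le_max_right 1 (4 * B / c); linarith
  have h4 : J / V < t := by
    have := le_max_right T (max 1 (4 * B / c)); have := le_max_left 1 (4 * B / c); linarith
  rw [div_le_iff₀ hc] at h3
  rw [div_lt_iff₀ hVpos] at h4
  have hIt : Integrable (fun x => g (t • x)) := hI.comp_smul (by linarith)
  have key : ∀ x ∈ ball θ ρ, 1 ≤ g (t • x) := by
    intro x hx
    have hxM : ‖x‖ ≤ M := by
      have := norm_le_norm_add_norm_sub' x θ
      rw [mem_ball, dist_eq_norm] at hx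
      linarith
    rw [hg]
    apply Real.one_le_exp
    have hh := h x hx t h1
    rw [norm_smul, mul_pow, Real.norm_eq_abs, sq_abs]
    have e1 : δ * (t^2 * ‖x‖^2) ≤ n * (c/2 * t^2) := by
      calc δ * (t^2 * ‖x‖^2) ≤ δ * (t^2 * M^2) := by gcongr
        _ = n * (c/2 * t^2) := by rw [hδ]; field_simp
    have e2 : c/2 * t^2 ≤ u (t • x) := by nlinarith
    nlinarith
  have hle : V ≤ ∫ x, g (t • x) := by
    calc V = ∫ x in ball θ ρ, (1:ℝ) := by simp [hV]
      _ ≤ ∫ x in ball θ ρ, g (t • x) :=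
        setIntegral_mono_on (integrableOn_const measure_ball_lt_top.ne) hIt.integrableOn measurableSet_ball key
      _ ≤ ∫ x, g (t • x) := setIntegral_le_integral hIt (Eventually.of_forall fun x => (exp_pos _).le)
  rw [Measure.integral_comp_smul] at hle
  have hpow : t ≤ t ^ Module.finrank ℝ (EuclideanSpace ℝ (Fin n)) := by
    simp only [finrank_euclideanSpace, Fintype.card_fin]
    exact le_self_pow₀ h2 (by omega)
  rw [abs_of_nonneg (by positivity), smul_eq_mul, ← hJ] at hle
  have htp : 0 < t := by linarith
  have : t⁻¹ * J < V := by rw [inv_mul_lt_iff₀ htp]; exact h4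
  have : (t ^ Module.finrank ℝ (EuclideanSpace ℝ (Fin n)))⁻¹ * J ≤ t⁻¹ * J := by gcongr
  linarith

lemma no_decay (hn : 2 ≤ n) {u f : EuclideanSpace ℝ (Fin n) → ℝ} (hu : Continuous u)
    (hfc : Continuous f) (hf : Integrable f)
    (hcomplete : ∀ θ : EuclideanSpace ℝ (Fin n), ‖θ‖ = 1 →
      ∫⁻ r in Set.Ioi (0 : ℝ), ENNReal.ofReal (Real.exp (u (r • θ))) = ⊤)
    {θ : EuclideanSpace ℝ (Fin n)} {ρ c B T R0 b : ℝ} (hρ : 0 < ρ) (hρθ : ρ ≤ ‖θ‖) (hc : 0 < c)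
    (hB : 0 ≤ B) (hb : 0 ≤ b) (hT : 1 ≤ T)
    (h : ∀ x ∈ ball θ ρ, ∀ t ≥ T, exp (u (t • x)) ≤ B * exp (-c * t) *
      (1 + b * ∫ y in (ball 0 R0)ᶜ, max 1 (‖t • x - y‖⁻¹) * f y)) : False := by
  obtain ⟨C, hC, hk⟩ := k_ball_bound hn θ ρ
  set D : ℝ≥0∞ := volume (ball θ ρ) + ENNReal.ofReal b * (C * ∫⁻ y, ‖f y‖ₑ) with hD
  have hfi : ∫⁻ y, ‖f y‖ₑ < ⊤ := hf.2
  have hDfin : D < ⊤ := by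
    rw [hD]
    exact ENNReal.add_lt_top.2 ⟨measure_ball_lt_top,
      ENNReal.mul_lt_top ENNReal.ofReal_lt_top (ENNReal.mul_lt_top hC hfi)⟩
  have pt : ∀ t ≥ T, ∀ x ∈ ball θ ρ, ENNReal.ofReal (exp (u (t • x))) ≤
      ENNReal.ofReal (B * exp (-c * t)) * (1 + ENNReal.ofReal b *
        ∫⁻ y, ENNReal.ofReal (max 1 (‖x - t⁻¹ • y‖⁻¹)) * ‖f y‖ₑ) := by
    intro t ht x hx
    have htp : 0 < t := by linarith
    refine (ENNReal.ofReal_le_ofReal (h x hx t ht)).trans ?_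
    rw [ENNReal.ofReal_mul (by positivity)]
    gcongr
    refine ENNReal.ofReal_add_le.trans ?_
    rw [ENNReal.ofReal_one, ENNReal.ofReal_mul hb]
    gcongr
    calc ENNReal.ofReal (∫ y in (ball 0 R0)ᶜ, max 1 (‖t • x - y‖⁻¹) * f y)
        ≤ ‖∫ y in (ball 0 R0)ᶜ, max 1 (‖t • x - y‖⁻¹) * f y‖ₑ := by
          rw [← ofReal_norm]; exact ENNReal.ofReal_le_ofReal (le_abs_self _)
      _ ≤ ∫⁻ y in (ball 0 R0)ᶜ, ‖max 1 (‖t • x - y‖⁻¹) * f y‖ₑ := enorm_integral_le_lintegral_enorm _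
      _ ≤ ∫⁻ y, ‖max 1 (‖t • x - y‖⁻¹) * f y‖ₑ := setLIntegral_le_lintegral _ _
      _ ≤ _ := by
        apply lintegral_mono
        intro y
        simp only [enorm_mul]
        gcongr
        rw [Real.enorm_of_nonneg (by positivity)]
        apply ENNReal.ofReal_le_ofReal
        have e : t • x - y = t • (x - t⁻¹ • y) := by
          rw [smul_sub, smul_smul, mul_inv_cancel₀ htp.ne', one_smul]
        rw [e, norm_smul, Real.norm_of_nonneg htp.le, mul_inv]
        gcongr
        have : t⁻¹ ≤ 1 := inv_le_one_of_one_le₀ (by linarith)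
        exact mul_le_of_le_one_left (by positivity) this
  have pt2 : ∀ t ∈ Set.Ioi T, ∫⁻ x in ball θ ρ, ENNReal.ofReal (exp (u (t • x))) ≤
      ENNReal.ofReal (B * exp (-c * t)) * D := by
    intro t ht
    refine (setLIntegral_mono' measurableSet_ball (pt t (le_of_lt ht))).trans ?_
    rw [lintegral_const_mul' _ _ ENNReal.ofReal_ne_top]
    gcongr
    rw [lintegral_add_left measurable_const, lintegral_const_mul' _ _ ENNReal.ofReal_ne_top, hD]
    gcongr
    · simp
    rw [lintegral_lintegral_swap (by
      apply Measurable.aemeasurable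
      have := hfc.measurable
      unfold Function.uncurry
      fun_prop)]
    calc _ ≤ ∫⁻ y, C * ‖f y‖ₑ := by
            apply lintegral_mono
            intro y
            simp only
            rw [lintegral_mul_const' _ _ enorm_ne_top]
            gcongr
            exact hk _
      _ = _ := by rw [lintegral_const_mul' _ _ hC.ne]
  have hG : Measurable (Function.uncurry fun (t:ℝ) (x : EuclideanSpace ℝ (Fin n)) => ENNReal.ofReal (exp (u (t • x)))) := by
    have := hu.measurable
    unfold Function.uncurry
    fun_prop
  have tot : ∫⁻ t in Set.Ioi T, ∫⁻ x in ball θ ρ, ENNReal.ofReal (exp (u (t • x))) < ⊤ := by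
    refine (setLIntegral_mono' measurableSet_Ioi pt2).trans_lt ?_
    rw [lintegral_mul_const' _ _ hDfin.ne]
    refine ENNReal.mul_lt_top ?_ hDfin
    have : IntegrableOn (fun t => B * exp (-c * t)) (Set.Ioi T) := (exp_neg_integrableOn_Ioi T hc).const_mul B
    exact Integrable.lintegral_lt_top this
  rw [lintegral_lintegral_swap hG.aemeasurable] at tot
  have hae := ae_lt_top' (Measurable.lintegral_prod_left' (μ := volume.restrict (Set.Ioi T)) hG).aemeasurable tot.ne
  have hne : NeBot (ae (volume.restrict (ball θ ρ))) := by
    rw [ae_neBot]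
    intro h0
    rw [Measure.restrict_eq_zero] at h0
    exact (measure_ball_pos _ _ hρ).ne' h0
  obtain ⟨x, hx1, hx2⟩ := (hae.and (ae_restrict_mem measurableSet_ball)).exists
  have hx0 : 0 < ‖x‖ := by
    rw [norm_pos_iff]
    rintro rfl
    rw [mem_ball, dist_eq_norm, zero_sub, norm_neg] at hx2
    linarith
  have hcont : Continuous fun t : ℝ => exp (u (t • x)) := by fun_prop
  have i1 : IntegrableOn (fun t : ℝ => exp (u (t • x))) (Set.Ioi T) := by
    refine ⟨hcont.aestronglyMeasurable, ?_⟩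
    rw [hasFiniteIntegral_iff_ofReal (Eventually.of_forall fun _ => (exp_pos _).le)]
    exact hx1
  have i2 : IntegrableOn (fun t : ℝ => exp (u (t • x))) (Set.Ioi 0) := by
    rw [← Set.Ioc_union_Ioi_eq_Ioi (show (0:ℝ) ≤ T by linarith)]
    exact (hcont.integrableOn_Ioc).union i1
  have i3 : IntegrableOn (fun t : ℝ => exp (u (t • ((‖x‖⁻¹) • x)))) (Set.Ioi 0) := by
    
    have := (integrableOn_Ioi_comp_mul_left_iff (fun t : ℝ => exp (u (t • x))) 0 (inv_pos.2 hx0)).2 (by simpa using i2)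
    simpa [smul_smul, mul_comm] using this
  have i4 := Integrable.lintegral_lt_top i3
  rw [hcomplete _ (by rw [norm_smul, norm_inv, norm_norm, inv_mul_cancel₀ hx0.ne'])] at i4
  exact lt_irrefl _ i4

end


section
variable {n : ℕ}

lemma log_absorb {A M c : ℝ} (hA : 0 ≤ A) (hM : 0 < M) (hc : 0 < c) :
    ∃ B, 0 ≤ B ∧ ∀ s t : ℝ, 0 < s → s ≤ 2 * t * M → A + A * log s ≤ B + c * t := by
  set K := 2 * (A + 1) * M / c with hK
  have hKp : 0 < K := by positivity
  refine ⟨|A * log K|, abs_nonneg _, fun s t hs hst => ?_⟩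
  have h1 : log s = log K + log (s / K) := by rw [log_div hs.ne' hKp.ne']; ring
  have h2 : log (s / K) ≤ s / K - 1 := log_le_sub_one_of_pos (by positivity)
  have ht : 0 < t := by
    by_contra h; push Not at h; nlinarith
  have h3 : A * (s / K) ≤ c * t := by
    calc A * (s / K) ≤ (A + 1) * ((2 * t * M) / K) := by gcongr; linarith
      _ = c * t := by rw [hK]; field_simp
  have h4 := le_abs_self (A * log K)
  have h5 := mul_le_mul_of_nonneg_left h2 hA
  rw [h1]; nlinarith

lemma ball_scale {θ x : EuclideanSpace ℝ (Fin n)} {ρ t R0 : ℝ} (hθ : 0 < ‖θ‖) (hρ : ρ ≤ ‖θ‖ / 2)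
    (hx : x ∈ ball θ ρ) (ht : 0 < t) (htR : 4 * R0 / ‖θ‖ ≤ t) :
    2 * R0 ≤ ‖t • x‖ ∧ 2 * ‖t • x‖ ≤ 2 * t * (2 * ‖θ‖) := by
  rw [mem_ball, dist_eq_norm] at hx
  have h1 := norm_le_norm_add_norm_sub' x θ
  have h2 := norm_le_norm_add_norm_sub θ x
  rw [norm_smul, Real.norm_of_nonneg ht.le]
  rw [div_le_iff₀ hθ] at htR
  rw [norm_sub_rev] at h2
  have h3 : ‖θ‖ / 2 ≤ ‖x‖ := by
    have := norm_sub_norm_le θ x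
    rw [norm_sub_rev] at this
    linarith
  constructor
  · nlinarith
  · nlinarith

lemma top_coeff {H : EuclideanSpace ℝ (Fin n) → ℝ} (h0 : H 0 = 0) (a : ℕ → EuclideanSpace ℝ (Fin n) → ℝ) (K : ℕ)
    (h : ∀ x (t : ℝ), H (t • x) = ∑ i ∈ Finset.range (K+1), a i x * t^i) :
    (∀ x, H x = 0) ∨ ∃ d, 1 ≤ d ∧ (∃ x, a d x ≠ 0) ∧
      ∀ x (t : ℝ), H (t • x) = ∑ i ∈ Finset.range (d+1), a i x * t^i := by
  induction K with
  | zero =>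
    left; intro x
    have h1 := h x 1
    have h2 := h x 0
    simp at h1 h2
    rw [h1, ← h2, h0]
  | succ K ih =>
    by_cases hz : ∀ x, a (K+1) x = 0
    · apply ih
      intro x t
      rw [h x t, Finset.sum_range_succ, hz]; simp
    · push Not at hz
      exact Or.inr ⟨K+1, by omega, hz, h⟩

lemma endgame (hn : 2 ≤ n) {u f : EuclideanSpace ℝ (Fin n) → ℝ} (hu : Continuous u)
    (hfc : Continuous f) (hf : Integrable f)
    (hpos : ∃ R1, ∀ y : EuclideanSpace ℝ (Fin n), R1 ≤ ‖y‖ → 0 ≤ f y)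
    (hexp : ∀ δ > (0:ℝ), Integrable (fun x => exp (n * u x - δ * ‖x‖^2)))
    (hcomplete : ∀ θ : EuclideanSpace ℝ (Fin n), ‖θ‖ = 1 →
      ∫⁻ r in Set.Ioi (0 : ℝ), ENNReal.ofReal (Real.exp (u (r • θ))) = ⊤)
    {H : EuclideanSpace ℝ (Fin n) → ℝ} (hH : ∀ x, H x = u x - u 0 - Npot f x)
    (h0 : H 0 = 0) (a : ℕ → EuclideanSpace ℝ (Fin n) → ℝ) (ha : ∀ i, Continuous (a i)) (K : ℕ)
    (h : ∀ x (t : ℝ), H (t • x) = ∑ i ∈ Finset.range (K+1), a i x * t^i) :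
    ∀ x, H x = 0 := by
  rcases top_coeff h0 a K h with h1 | ⟨d, hd, ⟨x0, hx0⟩, hs⟩
  · exact h1
  exfalso
  obtain ⟨R0, hR0, hfR0, htail⟩ := exists_R0 hf hpos (cconst_pos n)
  obtain ⟨A, hA, hN⟩ := N_bounds hn hfc hf hR0 hfR0 htail
  -- no negative direction
  have hneg : ∀ θ, ¬ a d θ < 0 := by
    intro θ hθ
    obtain ⟨ρ, hρ, c, hc, T, hT, hb⟩ := poly_asymp hd a ha hθ
    have hθ0 : 0 < ‖θ‖ := by
      rw [norm_pos_iff]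
      rintro rfl
      have e := hb 0 (mem_ball_self hρ) T le_rfl
      rw [← hs, smul_zero, h0] at e
      have : 0 < c * T ^ d := by positivity
      linarith
    obtain ⟨B, hB, hBt⟩ := log_absorb hA (show 0 < 2 * ‖θ‖ by positivity) (half_pos hc)
    have hT' : 1 ≤ max T (4 * R0 / ‖θ‖) := hT.le.trans (le_max_left _ _)
    refine no_decay (θ := θ) (ρ := min ρ (‖θ‖/2)) (c := c/2) (B := exp (u 0 + B)) (b := 1 / cconst n)
      (R0 := R0) (T := max T (4 * R0 / ‖θ‖)) hn hu hfc hf hcomplete (by positivity)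
      ((min_le_right _ _).trans (by linarith)) (half_pos hc) (exp_pos _).le
      (by have := cconst_pos n; positivity) hT' ?_
    intro x hx t ht
    have ht1 : 1 ≤ t := hT'.trans ht
    obtain ⟨s1, s2⟩ := ball_scale hθ0 (min_le_right _ _) hx (by linarith) ((le_max_right _ _).trans ht)
    obtain ⟨-, N2⟩ := hN _ s1
    have hb1 := hb x (ball_subset_ball (min_le_left _ _) hx) t ((le_max_left _ _).trans ht)
    rw [← hs] at hb1
    have hl := hBt _ t (by linarith) s2
    have hpow : t ≤ t^d := le_self_pow₀ ht1 (by omega)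
    have hcp : c * t ≤ c * t^d := by gcongr
    set W := 1 + 1 / cconst n * ∫ y in (ball 0 R0)ᶜ, max 1 (‖t • x - y‖⁻¹) * f y with hW
    have hWp : 0 < W := by
      have := (exp_pos _).trans_le N2
      exact pos_of_mul_pos_right this (exp_pos _).le
    have hue : u (t • x) = u 0 + H (t • x) + Npot f (t • x) := by rw [hH]; ring
    calc exp (u (t • x)) = exp (u 0 + H (t • x)) * exp (Npot f (t • x)) := by rw [hue, exp_add]
      _ ≤ exp (u 0 + H (t • x)) * (exp (A + A * log (2 * ‖t • x‖)) * W) := by gcongr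
      _ = exp (u 0 + H (t • x) + (A + A * log (2 * ‖t • x‖))) * W := by rw [← mul_assoc, ← exp_add]
      _ ≤ exp ((u 0 + B) + -(c/2) * t) * W := by
        refine mul_le_mul_of_nonneg_right (exp_le_exp.2 ?_) hWp.le
        linarith
      _ = _ := by rw [exp_add]
  have hx0p : 0 < a d x0 := lt_of_le_of_ne (not_lt.1 (hneg x0)) hx0.symm
  rcases (show d = 1 ∨ 2 ≤ d by omega) with rfl | hd2
  · have e1 : ∀ x, H x = a 0 x + a 1 x := by
      intro x
      have := hs x 1
      simpa [Finset.sum_range_succ] using this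
    have e0 : ∀ x, a 0 x = 0 := by
      intro x
      have := hs x 0
      simp [Finset.sum_range_succ, h0] at this
      exact this.symm
    have e2 := hs x0 (-1)
    simp only [Finset.sum_range_succ, Finset.sum_range_zero, e0] at e2
    rw [e1, e0, neg_one_smul] at e2
    apply hneg (-x0)
    linarith
  · obtain ⟨ρ, hρ, c, hc, T, hT, hb⟩ := poly_asymp hd (fun i x => - a i x) (fun i => (ha i).neg)
      (θ := x0) (by simpa using hx0p)
    have hb' : ∀ x ∈ ball x0 ρ, ∀ t ≥ T, c * t^d ≤ H (t • x) := by
      intro x hx t ht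
      have := hb x hx t ht
      simp only [neg_mul, Finset.sum_neg_distrib] at this
      rw [hs]; linarith
    have hθ0 : 0 < ‖x0‖ := by
      rw [norm_pos_iff]
      rintro rfl
      have e := hb' 0 (mem_ball_self hρ) T le_rfl
      rw [smul_zero, h0] at e
      have : 0 < c * T ^ d := by positivity
      linarith
    obtain ⟨B, hB, hBt⟩ := log_absorb hA (show 0 < 2 * ‖x0‖ by positivity) one_pos
    have hT' : 1 ≤ max T (4 * R0 / ‖x0‖) := hT.le.trans (le_max_left _ _)
    refine no_growth (θ := x0) (ρ := min ρ (‖x0‖/2)) (c := c) (B := B + |u 0| + 1)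
      (T := max T (4 * R0 / ‖x0‖)) (by omega) hexp (by positivity) hc (by positivity) ?_
    intro x hx t ht
    have ht1 : 1 ≤ t := hT'.trans ht
    obtain ⟨s1, s2⟩ := ball_scale hθ0 (min_le_right _ _) hx (by linarith) ((le_max_right _ _).trans ht)
    obtain ⟨N1, -⟩ := hN _ s1
    have hb1 := hb' x (ball_subset_ball (min_le_left _ _) hx) t ((le_max_left _ _).trans ht)
    have hl := hBt _ t (by linarith) s2
    have hpow : c * t^2 ≤ c * t^d := by gcongr
    have hue : u (t • x) = u 0 + H (t • x) + Npot f (t • x) := by rw [hH]; ring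
    have hab := neg_abs_le (u 0)
    have h3 : 0 ≤ (B + |u 0|) * t := by positivity
    nlinarith

end

theorem stmt5 (m n : ℕ) (hm : 2 ≤ m) (hn : n = 2 * m)
    (u Q : EuclideanSpace ℝ (Fin n) → ℝ) (hu : ContDiff ℝ (⊤ : ℕ∞) u)
    (hPDE : ∀ x, negLapIter m u x = 2 * Q x * Real.exp (n * u x))
    (hf : MeasureTheory.Integrable (fun y => Q y * Real.exp (n * u y)))
    (hQ : ∀ δ > (0 : ℝ), ∃ Rδ : ℝ, ∀ x : EuclideanSpace ℝ (Fin n), Rδ ≤ ‖x‖ →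
      Real.exp (-δ * ‖x‖ ^ 2) ≤ Q x)
    (hcomplete : ∀ θ : EuclideanSpace ℝ (Fin n), ‖θ‖ = 1 →
      ∫⁻ r in Set.Ioi (0 : ℝ), ENNReal.ofReal (Real.exp (u (r • θ))) = ⊤) :
    ∃ C : ℝ, ∀ x : EuclideanSpace ℝ (Fin n),
      u x = (1 / cconst n) * (∫ y, Real.log (‖y‖ / ‖x - y‖) * (Q y * Real.exp (n * u y))) + C := by
  set f : EuclideanSpace ℝ (Fin n) → ℝ := fun y => Q y * Real.exp (n * u y) with hfdef
  have hP : ∀ x, negLapIter m u x = 2 * f x := fun x => by rw [hPDE, hfdef]; ring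
  have hfc : Continuous f := by
    have e : f = fun x => negLapIter m u x / 2 := by funext x; rw [hP]; ring
    rw [e]
    exact (contDiff_negLapIter u hu m).continuous.div_const 2
  have hn2 : 2 ≤ n := by omega
  have hexp : ∀ δ > (0:ℝ), Integrable (fun x => exp (n * u x - δ * ‖x‖^2)) :=
    fun δ hδ => exp_integrable u Q hu.continuous hf hQ hδ
  have hpos : ∃ R1, ∀ y : EuclideanSpace ℝ (Fin n), R1 ≤ ‖y‖ → 0 ≤ f y := by
    obtain ⟨R, hR⟩ := hQ 1 one_pos
    exact ⟨R, fun y hy => mul_nonneg ((exp_pos _).le.trans (hR y hy)) (exp_pos _).le⟩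
  have hl := H_line (by omega) hn u f hu hfc hf hP (hexp 1 one_pos) (H := fun x => u x - u 0 - Npot f x) rfl
  have hHc : Continuous (fun x => u x - u 0 - Npot f x) :=
    (hu.continuous.sub continuous_const).sub (Npot_continuous hn2 hfc hf)
  obtain ⟨a, ha, hs⟩ := line_coeffs hHc hl
  have hN0 : Npot f 0 = 0 := by
    have : ∀ y : EuclideanSpace ℝ (Fin n), log (‖y‖ / ‖0 - y‖) * f y = 0 := by
      intro y
      rw [zero_sub, norm_neg]
      by_cases hy : ‖y‖ = 0
      · simp [hy]
      · rw [div_self hy]; simp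
    unfold Npot
    simp only [this, integral_zero, mul_zero]
  have hz := endgame hn2 hu.continuous hfc hf hpos hexp hcomplete
    (H := fun x => u x - u 0 - Npot f x) (fun _ => rfl) (by simp [hN0]) a ha _ hs
  refine ⟨u 0, fun x => ?_⟩
  have : u x - u 0 - Npot f x = 0 := hz x
  change u x = Npot f x + u 0
  linarith
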